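/- arXiv:math/9907106 — 2 statements merged into one kernel-verified Lean document; each statement's English description precedes it below -/
import Mathlib

section
/- Let (A,R) be a minimal triangular pointed Hopf algebra over an algebraically closed field k of characteristic 0, and set K := k[G(A)], the group algebra of the group of grouplike elements of A. Then there exists a projection of Hopf algebras π: A → K (i.e. a surjective Hopf algebra map with π restricted to K the identity), and consequently A = B × K is a biproduct in the sense of Radford, where B = {x ∈ A | (I⊗π)Δ(x) = x⊗1} ⊆ A. -/
open TensorProduct

noncomputable section

universe u v w

namespace Paper

variable (k : Type*) [Field k]

section Basic

variable (A : Type*) [Ring A] [HopfAlgebra k A]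

/-- `g` is a grouplike element of the Hopf algebra `A`. -/
def IsGrouplike (g : A) : Prop :=
  Coalgebra.counit (R := k) g = 1 ∧ Coalgebra.comul (R := k) g = g ⊗ₜ[k] g

/-- `x` is a `g:h` skew primitive element of `A`, i.e. `Δ(x) = x ⊗ g + h ⊗ x`. -/
def IsSkewPrimitive (g h x : A) : Prop :=
  Coalgebra.comul (R := k) x = x ⊗ₜ[k] g + h ⊗ₜ[k] x

/-- The space `P_{g,h}(A)` of `g:h` skew primitives, as a submodule. -/
def skewPrimitives (g h : A) : Submodule k A :=
  LinearMap.ker (Coalgebra.comul (R := k) -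
    ((TensorProduct.mk k A A).flip g + TensorProduct.mk k A A h))

end Basic

section Coalg

variable {M : Type*} [AddCommGroup M] [Module k M]

/-- `C` is a subcoalgebra with respect to the comultiplication `d`. -/
def IsSubcoalgebraOf (d : M →ₗ[k] M ⊗[k] M) (C : Submodule k M) : Prop :=
  ∀ x ∈ C, d x ∈ LinearMap.range (TensorProduct.map C.subtype C.subtype)

/-- `C` is a simple subcoalgebra with respect to `d`. -/
def IsSimpleSubcoalgebraOf (d : M →ₗ[k] M ⊗[k] M) (C : Submodule k M) : Prop :=
  C ≠ ⊥ ∧ IsSubcoalgebraOf k d C ∧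
    ∀ D : Submodule k M, IsSubcoalgebraOf k d D → D ≤ C → D = ⊥ ∨ D = C

/-- A coalgebra is pointed if all its simple subcoalgebras are `1`-dimensional. -/
def IsPointedOf (d : M →ₗ[k] M ⊗[k] M) : Prop :=
  ∀ C : Submodule k M, IsSimpleSubcoalgebraOf k d C → Module.finrank k C = 1

/-- The coradical: the sum of all simple subcoalgebras. -/
def coradicalOf (d : M →ₗ[k] M ⊗[k] M) : Submodule k M :=
  sSup {C | IsSimpleSubcoalgebraOf k d C}

/-- The first term `A₁ = Δ⁻¹(A₀ ⊗ A + A ⊗ A₀)` of the coradical filtration. -/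
def firstCoradicalTermOf (d : M →ₗ[k] M ⊗[k] M) : Submodule k M :=
  Submodule.comap d
    (LinearMap.range (TensorProduct.map (coradicalOf k d).subtype (LinearMap.id (M := M))) ⊔
      LinearMap.range (TensorProduct.map (LinearMap.id (M := M)) (coradicalOf k d).subtype))

end Coalg

section Hopf

variable (A : Type*) [Ring A] [HopfAlgebra k A]

/-- A Hopf algebra is pointed if all its simple subcoalgebras are `1`-dimensional. -/
def IsPointed : Prop := IsPointedOf k (Coalgebra.comul (R := k) (A := A))

/-- A subalgebra `B` of `A` is a sub-Hopf-algebra if it is closed under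
comultiplication and under the antipode. -/
def IsSubHopf (B : Subalgebra k A) : Prop :=
  (∀ x ∈ B, Coalgebra.comul (R := k) x ∈
      LinearMap.range (TensorProduct.map B.toSubmodule.subtype B.toSubmodule.subtype)) ∧
  ∀ x ∈ B, HopfAlgebra.antipode (R := k) x ∈ B

/-- `r` belongs to `K ⊗ K ⊆ A ⊗ A` for a submodule `K` of `A`. -/
def MemTensorSquare (K : Submodule k A) (r : A ⊗[k] A) : Prop :=
  r ∈ LinearMap.range (TensorProduct.map K.subtype K.subtype)

/-- `(Δ ⊗ id)(r) = r₁₃ r₂₃`. -/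
def Hexagon₁ (r : A ⊗[k] A) : Prop :=
  Algebra.TensorProduct.map (Bialgebra.comulAlgHom k A) (AlgHom.id k A) r =
    Algebra.TensorProduct.map (Algebra.TensorProduct.includeLeft (R := k) (S := k)) (AlgHom.id k A) r *
      Algebra.TensorProduct.map (Algebra.TensorProduct.includeRight (R := k)) (AlgHom.id k A) r

/-- `(id ⊗ Δ)(r) = r₁₃ r₁₂`. -/
def Hexagon₂ (r : A ⊗[k] A) : Prop :=
  Algebra.TensorProduct.map (AlgHom.id k A) (Bialgebra.comulAlgHom k A) r =
    Algebra.TensorProduct.map (AlgHom.id k A) (Algebra.TensorProduct.includeRight (R := k)) r *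
      Algebra.TensorProduct.map (AlgHom.id k A) (Algebra.TensorProduct.includeLeft (R := k) (S := k)) r

/-- The Drinfeld element `u = Σ S(R⁽²⁾) R⁽¹⁾` associated to an element `r ∈ A ⊗ A`. -/
def drinfeldOf (r : A ⊗[k] A) : A :=
  LinearMap.mul' k A
    ((TensorProduct.map (HopfAlgebra.antipode (R := k)) LinearMap.id)
      ((TensorProduct.comm k A A) r))

/-- A quasitriangular structure on the Hopf algebra `A`. -/
structure QuasiTriangular where
  /-- the R-matrix -/
  R : A ⊗[k] A
  isUnit : IsUnit R
  intertwine : ∀ a : A,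
    (TensorProduct.comm k A A) (Coalgebra.comul (R := k) a) * R = R * Coalgebra.comul (R := k) a
  hexagon₁ : Hexagon₁ k A R
  hexagon₂ : Hexagon₂ k A R

variable {A}

/-- A quasitriangular Hopf algebra is triangular if `R R₂₁ = 1 ⊗ 1`. -/
def QuasiTriangular.IsTriangular (Q : QuasiTriangular k A) : Prop :=
  Q.R * (TensorProduct.comm k A A) Q.R = 1

/-- `(A,R)` is minimal if no proper sub-Hopf-algebra contains the components of `R`. -/
def QuasiTriangular.IsMinimal (Q : QuasiTriangular k A) : Prop :=
  ∀ B : Subalgebra k A, IsSubHopf k A B → MemTensorSquare k A B.toSubmodule Q.R → B = ⊤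

/-- The Drinfeld element of a quasitriangular Hopf algebra. -/
def QuasiTriangular.drinfeld (Q : QuasiTriangular k A) : A := drinfeldOf k A Q.R

/-- The map `f_R : A* → A`, `p ↦ (p ⊗ I)(R)`. -/
def fR (Q : QuasiTriangular k A) : Module.Dual k A →ₗ[k] A :=
  TensorProduct.lift
    (LinearMap.mk₂ k (fun a b => (Module.Dual.eval k A a).smulRight b)
      (fun a a' b => by ext p; simp [add_smul])
      (fun c a b => by ext p; simp [smul_smul])
      (fun a b b' => by ext p; simp [smul_add])
      (fun c a b => by ext p; simp [smul_comm (p a) c b])) Q.R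

/-- Radford's coinvariants `B = {x ∈ A | (I ⊗ π)Δ(x) = x ⊗ 1}` of a projection `π`. -/
def coinvariants (π : A →ₗ[k] A) : Submodule k A :=
  LinearMap.ker
    ((TensorProduct.map LinearMap.id π) ∘ₗ Coalgebra.comul (R := k) -
      (TensorProduct.mk k A A).flip 1)

end Hopf

section Slices

variable {k} {M N : Type*} [AddCommGroup M] [Module k M] [AddCommGroup N] [Module k N]

/-- The map `p ↦ (p ⊗ id)(t)` attached to a tensor `t`. -/
def sliceLeft (t : M ⊗[k] N) : Module.Dual k M →ₗ[k] N :=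
  (TensorProduct.lid k N).toLinearMap ∘ₗ (LinearMap.rTensorHom N).flip t

/-- The map `p ↦ (id ⊗ p)(t)` attached to a tensor `t`. -/
def sliceRight (t : M ⊗[k] N) : Module.Dual k N →ₗ[k] M :=
  (TensorProduct.rid k M).toLinearMap ∘ₗ (LinearMap.lTensorHom M).flip t

lemma sliceLeft_sum {ι : Type*} [Fintype ι] (a : ι → M) (b : ι → N) (p : Module.Dual k M) :
    sliceLeft (∑ i, a i ⊗ₜ[k] b i) p = ∑ i, p (a i) • b i := by
  simp [sliceLeft]

lemma sliceRight_sum {ι : Type*} [Fintype ι] (a : ι → M) (b : ι → N) (p : Module.Dual k N) :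
    sliceRight (∑ i, a i ⊗ₜ[k] b i) p = ∑ i, p (b i) • a i := by
  simp [sliceRight]

lemma exists_sum_slices (t : M ⊗[k] N) :
    ∃ (n : ℕ) (a : Fin n → M) (b : Fin n → N), t = ∑ i, a i ⊗ₜ[k] b i ∧
      (∀ i, a i ∈ LinearMap.range (sliceRight t)) ∧
      ∀ i, b i ∈ LinearMap.range (sliceLeft t) := by
  classical
  set L := LinearMap.range (sliceRight t)
  set V := LinearMap.range (sliceLeft t)
  have h1 : t ∈ LinearMap.range (V.subtype.lTensor M) := by
    let e := Module.Basis.ofVectorSpace k M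
    obtain ⟨c, hc⟩ := TensorProduct.eq_repr_basis_left e t
    have hcV : ∀ i, c i ∈ V := by
      intro i
      refine ⟨e.coord i, ?_⟩
      rw [← hc]
      simp [sliceLeft, Finsupp.sum, Finsupp.single_apply]
      intro h; exact h.symm
    rw [← hc]
    refine Submodule.sum_mem _ fun i _ => ⟨e i ⊗ₜ ⟨c i, hcV i⟩, by simp⟩
  obtain ⟨t', ht'⟩ := h1
  let e := Module.Basis.ofVectorSpace k V
  obtain ⟨c, hc⟩ := TensorProduct.eq_repr_basis_right e t'
  have hcL : ∀ i, c i ∈ L := by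
    intro i
    obtain ⟨q, hq⟩ := LinearMap.exists_extend (e.coord i)
    refine ⟨q, ?_⟩
    have hq' : ∀ v : V, q v = e.coord i v := fun v => LinearMap.congr_fun hq v
    rw [← ht', ← hc]
    simp [sliceRight, Finsupp.sum, hq', Finsupp.single_apply]
    intro h; exact h.symm
  obtain ⟨s, hs⟩ : t ∈ LinearMap.range (TensorProduct.map L.subtype V.subtype) := by
    rw [← ht', ← hc, Finsupp.sum, map_sum]
    refine Submodule.sum_mem _ fun i _ => ⟨⟨c i, hcL i⟩ ⊗ₜ e i, by simp⟩
  obtain ⟨n, x, y, rfl⟩ := TensorProduct.exists_sum_tmul_eq s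
  exact ⟨n, fun i => x i, fun i => y i, by simp [← hs], fun i => (x i).2, fun i => (y i).2⟩

end Slices

section Contractions

variable {k} {A : Type*} [Ring A] [HopfAlgebra k A] {ι : Type*} [Fintype ι] {a b : ι → A}

lemma hexagon₁_sum (h : Hexagon₁ k A (∑ i, a i ⊗ₜ[k] b i)) :
    ∑ i, Coalgebra.comul (R := k) (a i) ⊗ₜ[k] b i =
      ∑ i, ∑ j, (a i ⊗ₜ[k] a j) ⊗ₜ[k] (b i * b j) := by
  simpa [Hexagon₁, Finset.sum_mul_sum] using h

lemma hexagon₂_sum (h : Hexagon₂ k A (∑ i, a i ⊗ₜ[k] b i)) :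
    ∑ i, a i ⊗ₜ[k] Coalgebra.comul (R := k) (b i) =
      ∑ i, ∑ j, (a i * a j) ⊗ₜ[k] (b j ⊗ₜ[k] b i) := by
  simpa [Hexagon₂, Finset.sum_mul_sum] using h

lemma sum_counit_left (hu : IsUnit (∑ i, a i ⊗ₜ[k] b i))
    (h : Hexagon₁ k A (∑ i, a i ⊗ₜ[k] b i)) :
    ∑ i, Coalgebra.counit (R := k) (a i) • b i = 1 := by
  have h1 := congrArg (LinearMap.rTensor A ((TensorProduct.lid k A).toLinearMap ∘ₗ
    LinearMap.rTensor A (Coalgebra.counit (R := k) (A := A)))) (hexagon₁_sum h)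
  simp only [map_sum, LinearMap.rTensor_tmul, LinearMap.comp_apply, LinearEquiv.coe_coe,
    Coalgebra.rTensor_counit_comul, TensorProduct.lid_tmul, one_smul] at h1
  have h2 : (1 : A ⊗[k] A) * (∑ i, a i ⊗ₜ[k] b i) =
      (1 ⊗ₜ[k] ∑ i, Coalgebra.counit (R := k) (a i) • b i) * ∑ i, a i ⊗ₜ[k] b i := by
    conv_lhs => rw [one_mul, h1]
    rw [TensorProduct.tmul_sum, Finset.sum_mul_sum]
    simp [TensorProduct.smul_tmul']
  have h3 := congrArg ((TensorProduct.lid k A).toLinearMap ∘ₗ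
    LinearMap.rTensor A (Coalgebra.counit (R := k) (A := A))) (hu.mul_right_cancel h2)
  simpa [Algebra.TensorProduct.one_def] using h3.symm

lemma sum_counit_right (hu : IsUnit (∑ i, a i ⊗ₜ[k] b i))
    (h : Hexagon₂ k A (∑ i, a i ⊗ₜ[k] b i)) :
    ∑ i, Coalgebra.counit (R := k) (b i) • a i = 1 := by
  have h1 := congrArg (LinearMap.lTensor A ((TensorProduct.rid k A).toLinearMap ∘ₗ
    LinearMap.lTensor A (Coalgebra.counit (R := k) (A := A)))) (hexagon₂_sum h)
  simp only [map_sum, LinearMap.lTensor_tmul, LinearMap.comp_apply, LinearEquiv.coe_coe,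
    Coalgebra.lTensor_counit_comul, TensorProduct.rid_tmul, one_smul] at h1
  have h2 : (1 : A ⊗[k] A) * (∑ i, a i ⊗ₜ[k] b i) =
      ((∑ i, Coalgebra.counit (R := k) (b i) • a i) ⊗ₜ[k] 1) * ∑ i, a i ⊗ₜ[k] b i := by
    conv_lhs => rw [one_mul, h1]
    rw [TensorProduct.sum_tmul, Finset.sum_mul_sum]
    simp [TensorProduct.smul_tmul']
  have h3 := congrArg ((TensorProduct.rid k A).toLinearMap ∘ₗ
    LinearMap.lTensor A (Coalgebra.counit (R := k) (A := A))) (hu.mul_right_cancel h2)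
  simpa [Algebra.TensorProduct.one_def] using h3.symm

lemma antipode_mul_self (hu : IsUnit (∑ i, a i ⊗ₜ[k] b i))
    (h : Hexagon₁ k A (∑ i, a i ⊗ₜ[k] b i)) :
    (∑ i, HopfAlgebra.antipode (R := k) (a i) ⊗ₜ[k] b i) * (∑ i, a i ⊗ₜ[k] b i) = 1 := by
  have h1 := congrArg (LinearMap.rTensor A (LinearMap.mul' k A ∘ₗ
    LinearMap.rTensor A (HopfAlgebra.antipode k (A := A)))) (hexagon₁_sum h)
  simp only [map_sum, LinearMap.rTensor_tmul, LinearMap.comp_apply,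
    HopfAlgebra.mul_antipode_rTensor_comul_apply, LinearMap.mul'_apply] at h1
  rw [Finset.sum_mul_sum]
  simp only [Algebra.TensorProduct.tmul_mul_tmul]
  have h2 : (1 : A ⊗[k] A) = 1 ⊗ₜ[k] ∑ i, Coalgebra.counit (R := k) (a i) • b i := by
    rw [sum_counit_left hu h, Algebra.TensorProduct.one_def]
  rw [← h1, h2, TensorProduct.tmul_sum]
  simp [Algebra.algebraMap_eq_smul_one, TensorProduct.smul_tmul]

lemma sum_antipode_of_triangular (hu : IsUnit (∑ i, a i ⊗ₜ[k] b i))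
    (h : Hexagon₁ k A (∑ i, a i ⊗ₜ[k] b i))
    (ht : (∑ i, a i ⊗ₜ[k] b i) * (∑ i, b i ⊗ₜ[k] a i) = 1) :
    ∑ i, HopfAlgebra.antipode (R := k) (a i) ⊗ₜ[k] b i = ∑ i, b i ⊗ₜ[k] a i :=
  left_inv_eq_right_inv (antipode_mul_self hu h) ht

end Contractions

section Minimality

variable {k} {A : Type*} [Ring A] [HopfAlgebra k A]

/-- The `R`-matrix of a minimal triangular Hopf algebra is a finite sum `∑ aᵢ ⊗ bᵢ` such that
both contractions `A* → A` are surjective. -/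
lemma QuasiTriangular.IsMinimal.exists_rep {Q : QuasiTriangular k A} (hmin : Q.IsMinimal)
    (htri : Q.IsTriangular) :
    ∃ (n : ℕ) (a b : Fin n → A), Q.R = ∑ i, a i ⊗ₜ[k] b i ∧
      (∀ y : A, ∃ p : Module.Dual k A, ∑ i, p (a i) • b i = y) ∧
      (∀ y : A, ∃ p : Module.Dual k A, ∑ i, p (b i) • a i = y) ∧ Module.Finite k A := by
  obtain ⟨n, a, b, hR, ha, hb⟩ := exists_sum_slices Q.R
  have hu := Q.isUnit
  have hx1 := Q.hexagon₁
  have hx2 := Q.hexagon₂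
  have ht : Q.R * (TensorProduct.comm k A A) Q.R = 1 := htri
  rw [hR] at hu hx1 hx2 ht ha hb
  simp only [map_sum, TensorProduct.comm_tmul] at ht
  set f := sliceLeft (∑ i, a i ⊗ₜ[k] b i)
  set f' := sliceRight (∑ i, a i ⊗ₜ[k] b i)
  have hf : ∀ p, f p = ∑ i, p (a i) • b i := fun p => sliceLeft_sum a b p
  have hf' : ∀ p, f' p = ∑ i, p (b i) • a i := fun p => sliceRight_sum a b p
  have hS := sum_antipode_of_triangular hu hx1 ht
  let S : A →ₗ[k] A := HopfAlgebra.antipode k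
  have hSf' : ∀ p, S (f' p) = f p := by
    intro p
    have := congrArg (fun t => sliceRight t p) hS
    simpa [sliceRight_sum, hf, hf', S] using this
  have hfS : ∀ p, f (p ∘ₗ S) = f' p := by
    intro p
    have := congrArg (fun t => sliceLeft t p) hS
    simpa [sliceLeft_sum, hf, hf', S] using this
  set V := LinearMap.range f
  set L := LinearMap.range f'
  have hLV : L ≤ V := by
    rintro _ ⟨p, rfl⟩
    exact ⟨_, hfS p⟩
  have hVL : V = L.map S := by
    ext x
    constructor
    · rintro ⟨p, rfl⟩
      exact ⟨f' p, ⟨p, rfl⟩, hSf' p⟩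
    · rintro ⟨_, ⟨p, rfl⟩, rfl⟩
      exact ⟨p, (hSf' p).symm⟩
  have hfinL : FiniteDimensional k L := by
    have := FiniteDimensional.span_of_finite k (Set.finite_range a)
    refine Submodule.finiteDimensional_of_le (S₂ := Submodule.span k (Set.range a)) ?_
    rintro _ ⟨p, rfl⟩
    rw [hf']
    exact Submodule.sum_mem _ fun i _ => Submodule.smul_mem _ _ (Submodule.subset_span ⟨i, rfl⟩)
  have hfinV : FiniteDimensional k V := by
    rw [hVL]; infer_instance
  have hLeq : L = V := by
    refine Submodule.eq_of_le_of_finrank_le hLV ?_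
    rw [hVL]
    exact Submodule.finrank_map_le S L
  have hone : (1 : A) ∈ V := ⟨Coalgebra.counit, by rw [hf, sum_counit_left hu hx1]⟩
  have hmul : ∀ x y, x ∈ V → y ∈ V → x * y ∈ V := by
    rintro _ _ ⟨p, rfl⟩ ⟨q, rfl⟩
    have := congrArg (fun t => sliceLeft t
      (LinearMap.mul' k k ∘ₗ TensorProduct.map p q)) (hexagon₁_sum hx1)
    refine ⟨LinearMap.mul' k k ∘ₗ TensorProduct.map p q ∘ₗ Coalgebra.comul, ?_⟩
    simp only [sliceLeft_sum] at this
    rw [hf, hf, hf, Finset.sum_mul_sum]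
    simp only [smul_mul_smul_comm]
    simpa [sliceLeft] using this
  have hcomul : ∀ x ∈ V, Coalgebra.comul (R := k) x ∈
      LinearMap.range (TensorProduct.map V.subtype V.subtype) := by
    rintro _ ⟨p, rfl⟩
    have := congrArg (fun t => sliceLeft t p) (hexagon₂_sum hx2)
    simp only [sliceLeft_sum] at this
    rw [hf, map_sum]
    simp only [map_smul]
    rw [this]
    simp only [sliceLeft, LinearMap.comp_apply, map_sum, LinearMap.sum_apply]
    refine Submodule.sum_mem _ fun i _ => Submodule.sum_mem _ fun j _ => ?_
    refine ⟨p (a i * a j) • (⟨b j, hb j⟩ ⊗ₜ ⟨b i, hb i⟩), ?_⟩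
    simp
  let H : Subalgebra k A :=
    { V.toAddSubmonoid with
      mul_mem' := fun {x y} hx hy => hmul x y hx hy
      one_mem' := hone
      algebraMap_mem' := fun r => by
        rw [Algebra.algebraMap_eq_smul_one]; exact V.smul_mem r hone }
  have hHV : H.toSubmodule = V := rfl
  have hH : H = ⊤ := by
    refine hmin H ⟨fun x hx => hcomul x hx, ?_⟩ ?_
    · intro x hx
      have hx' : x ∈ L := hLeq ▸ (show x ∈ V from hx)
      change S x ∈ V
      rw [hVL]
      exact ⟨x, hx', rfl⟩
    · unfold MemTensorSquare
      rw [hHV, hR]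
      exact Submodule.sum_mem _ fun i _ => ⟨⟨a i, hLV (ha i)⟩ ⊗ₜ ⟨b i, hb i⟩, by simp⟩
  have hV : V = ⊤ := by rw [← hHV, hH]; rfl
  refine ⟨n, a, b, hR, fun y => ?_, fun y => ?_, ?_⟩
  · obtain ⟨p, hp⟩ : y ∈ V := hV ▸ Submodule.mem_top
    exact ⟨p, by rw [← hf, hp]⟩
  · obtain ⟨p, hp⟩ : y ∈ L := hLeq ▸ hV ▸ Submodule.mem_top
    exact ⟨p, by rw [← hf', hp]⟩
  · rw [hV] at hfinV
    exact Module.finite_def.mpr (Submodule.fg_top _ |>.mp hfinV.1)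

end Minimality

section Pointed

variable {k} {A : Type*} [Ring A] [HopfAlgebra k A] {ι : Type*} [Fintype ι] {a b : ι → A}

lemma sliceLeft_mem {M : Type*} [AddCommGroup M] [Module k M] {D : Submodule k M}
    {t : M ⊗[k] M} (ht : t ∈ LinearMap.range (TensorProduct.map D.subtype D.subtype))
    (q : Module.Dual k M) : sliceLeft t q ∈ D := by
  obtain ⟨s, rfl⟩ := ht
  obtain ⟨n, x, y, rfl⟩ := TensorProduct.exists_sum_tmul_eq s
  simp only [map_sum, TensorProduct.map_tmul, sliceLeft_sum]
  exact D.sum_mem fun i _ => D.smul_mem _ (y i).2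

lemma sliceRight_mem {M : Type*} [AddCommGroup M] [Module k M] {D : Submodule k M}
    {t : M ⊗[k] M} (ht : t ∈ LinearMap.range (TensorProduct.map D.subtype D.subtype))
    (q : Module.Dual k M) : sliceRight t q ∈ D := by
  obtain ⟨s, rfl⟩ := ht
  obtain ⟨n, x, y, rfl⟩ := TensorProduct.exists_sum_tmul_eq s
  simp only [map_sum, TensorProduct.map_tmul, sliceRight_sum]
  exact D.sum_mem fun i _ => D.smul_mem _ (x i).2

lemma sum_sum_sum_comm {M α β γ : Type*} [AddCommMonoid M] [Fintype α] [Fintype β] [Fintype γ]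
    (F : α → β → γ → M) : ∑ i, ∑ j, ∑ m, F i j m = ∑ m, ∑ i, ∑ j, F i j m :=
  (Finset.sum_congr rfl fun _ _ => Finset.sum_comm).trans Finset.sum_comm

lemma comul_sum_smul (hx : Hexagon₂ k A (∑ i, a i ⊗ₜ[k] b i)) (p : Module.Dual k A) :
    Coalgebra.comul (R := k) (∑ i, p (a i) • b i) =
      ∑ i, ∑ j, p (a i * a j) • (b j ⊗ₜ[k] b i) := by
  have := congrArg (fun t => sliceLeft t p) (hexagon₂_sum hx)
  simp only [sliceLeft_sum] at this
  rw [map_sum]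
  simp only [map_smul]
  rw [this]
  simp [sliceLeft]

variable [Module.Finite k A]

/-- If a nondegenerate `R`-matrix lives on a pointed Hopf algebra, then the simple quotients of the
underlying algebra are one-dimensional. -/
lemma finrank_eq_one_of_surjective (hpointed : IsPointed k A)
    (hx : Hexagon₂ k A (∑ i, a i ⊗ₜ[k] b i))
    (hl : ∀ y : A, ∃ p : Module.Dual k A, ∑ i, p (a i) • b i = y)
    (hr : ∀ y : A, ∃ p : Module.Dual k A, ∑ i, p (b i) • a i = y)
    {E : Type*} [Ring E] [Algebra k E] [IsSimpleRing E] [FiniteDimensional k E]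
    (π : A →ₐ[k] E) (hπ : Function.Surjective π) : Module.finrank k E = 1 := by
  set f : Module.Dual k A →ₗ[k] A := sliceLeft (∑ i, a i ⊗ₜ[k] b i)
  have hf : ∀ p, f p = ∑ i, p (a i) • b i := fun p => sliceLeft_sum a b p
  have hfs : Function.Surjective f := fun y => by
    obtain ⟨p, hp⟩ := hl y
    exact ⟨p, by rw [hf, hp]⟩
  have hfi : Function.Injective f :=
    (LinearMap.injective_iff_surjective_of_finrank_eq_finrank
      Subspace.dual_finrank_eq).mpr hfs
  have hΔ : ∀ p, Coalgebra.comul (R := k) (f p) =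
      ∑ i, ∑ j, p (a i * a j) • (b j ⊗ₜ[k] b i) := fun p => by
    rw [hf, comul_sum_smul hx]
  let g : Module.Dual k E →ₗ[k] A := f ∘ₗ π.toLinearMap.dualMap
  have hg : Function.Injective g :=
    hfi.comp (LinearMap.dualMap_injective_of_surjective hπ)
  have hgf : ∀ p, g p = f (p ∘ₗ π.toLinearMap) := fun p => rfl
  set C := LinearMap.range g
  have hrank : Module.finrank k C = Module.finrank k E :=
    (LinearMap.finrank_range_of_inj hg).trans Subspace.dual_finrank_eq
  have hpos : 0 < Module.finrank k E := Module.finrank_pos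
  rw [← hrank]
  refine hpointed C ⟨?_, ?_, ?_⟩
  · intro h
    rw [h, finrank_bot] at hrank
    omega
  · rintro _ ⟨p, rfl⟩
    let e := Module.finBasis k E
    have key : Coalgebra.comul (R := k) (g p) =
        ∑ m, ∑ l, p (e m * e l) • (g (e.coord l) ⊗ₜ[k] g (e.coord m)) := by
      have hp : ∀ x y : E, p (x * y) =
          ∑ m, ∑ l, p (e m * e l) * (e.coord l y * e.coord m x) := by
        intro x y
        conv_lhs => rw [← e.sum_repr x, ← e.sum_repr y, Finset.sum_mul_sum]
        simp only [map_sum, smul_mul_smul_comm, map_smul, smul_eq_mul, Module.Basis.coord_apply]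
        refine Finset.sum_congr rfl fun m _ => Finset.sum_congr rfl fun l _ => ?_
        ring
      have hterm : ∀ m l, p (e m * e l) • (g (e.coord l) ⊗ₜ[k] g (e.coord m)) =
          ∑ i, ∑ j, (p (e m * e l) * (e.coord l (π (a j)) * e.coord m (π (a i)))) •
            (b j ⊗ₜ[k] b i) := by
        intro m l
        simp only [hgf, hf, TensorProduct.tmul_sum, TensorProduct.sum_tmul, Finset.smul_sum,
          TensorProduct.smul_tmul_smul, smul_smul, LinearMap.comp_apply,
          AlgHom.toLinearMap_apply]
      have hpa := fun i j => hp (π (a i)) (π (a j))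
      rw [hgf, hΔ]
      simp only [hterm, LinearMap.comp_apply, AlgHom.toLinearMap_apply, map_mul, hpa,
        Finset.sum_smul]
      rw [sum_sum_sum_comm]
      exact Finset.sum_congr rfl fun m _ => sum_sum_sum_comm _
    rw [key]
    exact Submodule.sum_mem _ fun m _ => Submodule.sum_mem _ fun l _ =>
      ⟨p (e m * e l) • (⟨_, ⟨e.coord l, rfl⟩⟩ ⊗ₜ ⟨_, ⟨e.coord m, rfl⟩⟩), by simp⟩
  · intro D hD hDC
    set W : Submodule k (Module.Dual k A) := D.comap f
    have hWl : ∀ p ∈ W, ∀ c : A, p ∘ₗ LinearMap.mulLeft k c ∈ W := by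
      intro p hp c
      obtain ⟨q, rfl⟩ := hr c
      have h := sliceRight_mem (hD _ hp) q
      rw [hΔ, Finset.sum_comm] at h
      change f _ ∈ D
      rw [hf]
      convert h using 1
      simp [sliceRight, Finset.sum_mul, Finset.sum_smul, smul_smul, mul_comm]
    have hWr : ∀ p ∈ W, ∀ c : A, p ∘ₗ LinearMap.mulRight k c ∈ W := by
      intro p hp c
      obtain ⟨q, rfl⟩ := hr c
      have h := sliceLeft_mem (hD _ hp) q
      rw [hΔ] at h
      change f _ ∈ D
      rw [hf]
      convert h using 1
      simp [sliceLeft, Finset.mul_sum, Finset.sum_smul, smul_smul, mul_comm]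
    set N := W.dualCoannihilator
    have hN : ∀ x, x ∈ N ↔ ∀ p ∈ W, p x = 0 := fun x => Submodule.mem_dualCoannihilator x
    have hker : ∀ x, π x = 0 → x ∈ N := by
      intro x hx0
      refine (hN x).mpr fun p hp => ?_
      obtain ⟨q, hq⟩ := hDC hp
      rw [← hfi hq]
      simp [hx0]
    let J : TwoSidedIdeal E := TwoSidedIdeal.mk' (π '' N) ⟨0, N.zero_mem, map_zero π⟩
      (by
        rintro _ _ ⟨x, hx, rfl⟩ ⟨y, hy, rfl⟩
        exact ⟨x + y, N.add_mem hx hy, map_add π x y⟩)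
      (by
        rintro _ ⟨x, hx, rfl⟩
        exact ⟨-x, N.neg_mem hx, map_neg π x⟩)
      (by
        rintro c _ ⟨y, hy, rfl⟩
        obtain ⟨c, rfl⟩ := hπ c
        exact ⟨c * y, (hN _).mpr fun p hp => (hN y).mp hy _ (hWl p hp c), map_mul π c y⟩)
      (by
        rintro _ c ⟨y, hy, rfl⟩
        obtain ⟨c, rfl⟩ := hπ c
        exact ⟨y * c, (hN _).mpr fun p hp => (hN y).mp hy _ (hWr p hp c), map_mul π y c⟩)
    have hJ : ∀ x, x ∈ J ↔ x ∈ π '' N := fun x => TwoSidedIdeal.mem_mk' ..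
    rcases IsSimpleRing.simple.eq_bot_or_eq_top J with h | h
    · right
      refine le_antisymm hDC ?_
      rintro _ ⟨p, rfl⟩
      change p ∘ₗ π.toLinearMap ∈ W
      rw [← Subspace.dualCoannihilator_dualAnnihilator_eq (W := W),
        Submodule.mem_dualAnnihilator]
      intro x hxN
      have : π x ∈ J := (hJ _).mpr ⟨x, hxN, rfl⟩
      rw [h, TwoSidedIdeal.mem_bot] at this
      simp [this]
    · left
      have h1 : (1 : E) ∈ J := h ▸ TwoSidedIdeal.mem_top E
      obtain ⟨u, hu, hu1⟩ := (hJ _).mp h1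
      have h1N : (1 : A) ∈ N := by
        have := N.sub_mem hu (hker (u - 1) (by simp [hu1]))
        simpa using this
      refine (Submodule.eq_bot_iff D).mpr fun x hxD => ?_
      obtain ⟨p, rfl⟩ := hfs x
      have hp0 : p = 0 := by
        ext y
        simpa using (hN 1).mp h1N _ (hWl p hxD y)
      rw [hp0, map_zero]

end Pointed

section Algebras

variable {k}

/-- In a finite-dimensional algebra whose simple quotients are one-dimensional, an element killed by
all characters is nilpotent. -/
lemma isNilpotent_of_forall_character [IsAlgClosed k] {A : Type*} [Ring A] [Algebra k A]
    [Module.Finite k A]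
    (h : ∀ (d : ℕ) [NeZero d] (π : A →ₐ[k] Matrix (Fin d) (Fin d) k), Function.Surjective π →
      Module.finrank k (Matrix (Fin d) (Fin d) k) = 1)
    {x : A} (hx : ∀ χ : A →ₐ[k] k, χ x = 0) : IsNilpotent x := by
  have := IsArtinianRing.of_finite k A
  obtain ⟨n, d, hd, ⟨e⟩⟩ :=
    IsSemisimpleRing.exists_algEquiv_pi_matrix_of_isAlgClosed k (A ⧸ Ring.jacobson A)
  have hx0 : e (Ideal.Quotient.mkₐ k (Ring.jacobson A) x) = 0 := by
    funext i
    let π : A →ₐ[k] Matrix (Fin (d i)) (Fin (d i)) k :=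
      (Pi.evalAlgHom k _ i).comp (e.toAlgHom.comp (Ideal.Quotient.mkₐ k (Ring.jacobson A)))
    have hπ : Function.Surjective π :=
      (Function.surjective_eval i).comp
        (e.surjective.comp (Ideal.Quotient.mkₐ_surjective k (Ring.jacobson A)))
    have := hd i
    have hbij := Algebra.finrank_eq_one_iff_bijective_algebraMap.mp (h (d i) π hπ)
    let c := AlgEquiv.ofBijective (Algebra.ofId k (Matrix (Fin (d i)) (Fin (d i)) k)) hbij
    have hc : c.symm (π x) = 0 := hx (c.symm.toAlgHom.comp π)
    exact c.symm.injective (hc.trans (map_zero c.symm).symm)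
  have hxJ : x ∈ Ring.jacobson A := by
    rw [← Ideal.Quotient.eq_zero_iff_mem]
    exact e.injective (hx0.trans (map_zero e).symm)
  obtain ⟨m, hm⟩ := IsSemiprimaryRing.isNilpotent (R := A)
  refine ⟨m, ?_⟩
  have := Ideal.pow_mem_pow hxJ m
  rw [hm] at this
  simpa using this

/-- A nil left ideal of a semisimple ring is zero. -/
lemma eq_zero_of_forall_isNilpotent_mul {S : Type*} [Ring S] [IsSemisimpleRing S] {x : S}
    (h : ∀ y : S, IsNilpotent (y * x)) : x = 0 := by
  have hx : x ∈ Ideal.jacobson (⊥ : Ideal S) := by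
    rw [Ideal.mem_jacobson_iff]
    intro y
    obtain ⟨u, hu⟩ := (h y).isUnit_one_add
    refine ⟨↑u⁻¹, ?_⟩
    rw [Ideal.mem_bot, sub_eq_zero, mul_assoc, ← mul_add_one, add_comm (y * x), ← hu]
    simp
  rw [Ideal.jacobson_bot, IsSemisimpleRing.jacobson_eq_bot] at hx
  simpa using hx

end Algebras

section Projection

variable {k} {A : Type*} [Ring A] [HopfAlgebra k A]

lemma isGrouplike_iff {g : A} : IsGrouplike k A g ↔ IsGroupLikeElem k g :=
  ⟨fun h => ⟨h.1, h.2⟩, fun h => ⟨h.1, h.2⟩⟩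

lemma setOf_isGrouplike : {g : A | IsGrouplike k A g} = Set.range (GroupLike.val (R := k)) := by
  ext g
  exact ⟨fun h => ⟨⟨g, isGrouplike_iff.mp h⟩, rfl⟩, by
    rintro ⟨g, rfl⟩
    exact isGrouplike_iff.mpr g.2⟩

/-- A nondegenerate `R`-matrix induces a bijection between characters and grouplike elements. -/
lemma nonempty_character_equiv_groupLike {ι : Type*} [Fintype ι] {a b : ι → A}
    [Module.Finite k A]
    (hu : IsUnit (∑ i, a i ⊗ₜ[k] b i)) (hx : Hexagon₂ k A (∑ i, a i ⊗ₜ[k] b i))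
    (hl : ∀ y : A, ∃ p : Module.Dual k A, ∑ i, p (a i) • b i = y)
    (hr : ∀ y : A, ∃ p : Module.Dual k A, ∑ i, p (b i) • a i = y) :
    Nonempty ((A →ₐ[k] k) ≃ GroupLike k A) := by
  have hcounit : ∀ p : Module.Dual k A,
      Coalgebra.counit (R := k) (∑ i, p (a i) • b i) = p 1 := by
    intro p
    rw [← sum_counit_right hu hx]
    simp [mul_comm]
  have hmul : ∀ χ : A →ₐ[k] k, Coalgebra.comul (R := k) (∑ i, χ.toLinearMap (a i) • b i) =
      (∑ i, χ.toLinearMap (a i) • b i) ⊗ₜ[k] (∑ i, χ.toLinearMap (a i) • b i) := by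
    intro χ
    rw [comul_sum_smul hx, Finset.sum_comm]
    simp only [TensorProduct.sum_tmul, TensorProduct.tmul_sum, TensorProduct.smul_tmul_smul,
      AlgHom.toLinearMap_apply, map_mul]
    rw [Finset.sum_comm]
    simp [mul_comm]
  let F : (A →ₐ[k] k) → GroupLike k A := fun χ =>
    ⟨∑ i, χ.toLinearMap (a i) • b i, ⟨by rw [hcounit]; simp, hmul χ⟩⟩
  refine ⟨Equiv.ofBijective F ⟨?_, ?_⟩⟩
  · intro χ χ' h
    have h' : sliceLeft (∑ i, a i ⊗ₜ[k] b i) χ.toLinearMap =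
        sliceLeft (∑ i, a i ⊗ₜ[k] b i) χ'.toLinearMap := by
      simpa only [sliceLeft_sum] using congrArg GroupLike.val h
    have hinj : Function.Injective (sliceLeft (∑ i, a i ⊗ₜ[k] b i)) :=
      (LinearMap.injective_iff_surjective_of_finrank_eq_finrank
        Subspace.dual_finrank_eq).mpr fun y => by
          obtain ⟨p, hp⟩ := hl y
          exact ⟨p, by rw [sliceLeft_sum, hp]⟩
    exact AlgHom.toLinearMap_injective (hinj h')
  · rintro ⟨g, hg⟩
    obtain ⟨p, hp⟩ := hl g
    have hp1 : p 1 = 1 := by rw [← hcounit, hp]; exact hg.counit_eq_one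
    have hpm : ∀ x y, p (x * y) = p x * p y := by
      intro x y
      obtain ⟨q, rfl⟩ := hr x
      obtain ⟨r, rfl⟩ := hr y
      have h := hg.comul_eq_tmul_self
      rw [← hp, comul_sum_smul hx] at h
      have h2 := congrArg (LinearMap.mul' k k ∘ₗ TensorProduct.map r q) h
      simp only [map_sum, map_smul, LinearMap.comp_apply, TensorProduct.map_tmul,
        LinearMap.mul'_apply, TensorProduct.sum_tmul, TensorProduct.tmul_sum, smul_eq_mul] at h2
      simp only [Finset.sum_mul_sum, map_sum, smul_mul_smul_comm, map_smul, smul_eq_mul]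
      refine Eq.trans ?_ (h2.trans ?_)
      · exact Finset.sum_congr rfl fun i _ => Finset.sum_congr rfl fun j _ => by ring
      · exact Finset.sum_congr rfl fun i _ => Finset.sum_congr rfl fun j _ => by ring
    exact ⟨AlgHom.ofLinearMap p hp1 hpm, by
      apply GroupLike.val_injective
      exact hp⟩

variable [Module.Finite k A]

lemma finite_groupLike : Finite (GroupLike k A) :=
  (linearIndep_groupLikeVal (R := k) (A := A)).finite

/-- If elements killed by all characters are nilpotent and there are as many characters as grouplike
elements, then the characters identify the span of the grouplikes with a quotient algebra. -/
lemma exists_algHom_projection [CharZero k]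
    (hnil : ∀ x : A, (∀ χ : A →ₐ[k] k, χ x = 0) → IsNilpotent x)
    (hX : Nonempty ((A →ₐ[k] k) ≃ GroupLike k A)) :
    ∃ (π : A →ₐ[k] A) (_ : Fintype (A →ₐ[k] k)) (e : (A →ₐ[k] k) → A),
      (∀ x, π x = ∑ χ : A →ₐ[k] k, χ x • e χ) ∧
      (∀ x, π x ∈ Submodule.span k {g : A | IsGrouplike k A g}) ∧
      (∀ g, IsGrouplike k A g → π g = g) ∧ ∀ (χ : A →ₐ[k] k) x, χ (π x) = χ x := by
  classical
  obtain ⟨E⟩ := hX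
  have := finite_groupLike (k := k) (A := A)
  have := Fintype.ofFinite (GroupLike k A)
  let _ : Fintype (A →ₐ[k] k) := Fintype.ofEquiv _ E.symm
  let G := GroupLike k A
  have : NeZero (Nat.card G : k) := ⟨by simp⟩
  let v : G →* A := ⟨⟨GroupLike.val, GroupLike.val_one⟩, GroupLike.val_mul⟩
  let ψ : MonoidAlgebra k G →ₐ[k] A := MonoidAlgebra.lift k A G v
  have hψ : ∀ g : G, ψ (MonoidAlgebra.of k G g) = g.val := fun g => by simp [ψ, v]
  have hψc : ∀ z, ψ z = Finsupp.linearCombination k (GroupLike.val (R := k) (A := A)) z.coeff :=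
    fun z => MonoidAlgebra.lift_apply _ _
  have hψi : Function.Injective ψ := fun z w h => by
    rw [hψc, hψc] at h
    exact MonoidAlgebra.coeff_injective (linearIndep_groupLikeVal h)
  let Φ : A →ₐ[k] ((A →ₐ[k] k) → k) := AlgHom.pi fun χ => χ
  have hΦψ : Function.Injective (Φ.comp ψ) := by
    refine (injective_iff_map_eq_zero _).mpr fun x hx => ?_
    refine eq_zero_of_forall_isNilpotent_mul fun y => ?_
    have h : IsNilpotent (ψ (y * x)) := hnil _ fun χ => by
      have := congrFun hx χ
      change χ (ψ x) = 0 at this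
      rw [map_mul, map_mul, this, mul_zero]
    exact (IsNilpotent.map_iff hψi).mp h
  have hbij : Function.Bijective (Φ.comp ψ) := by
    refine ⟨hΦψ, ?_⟩
    have hd : Module.finrank k (MonoidAlgebra k G) = Module.finrank k ((A →ₐ[k] k) → k) := by
      rw [(MonoidAlgebra.coeffLinearEquiv k).finrank_eq, Module.finrank_finsupp_self,
        Module.finrank_fintype_fun_eq_card, Fintype.card_congr E]
    exact (LinearMap.injective_iff_surjective_of_finrank_eq_finrank
      (f := (Φ.comp ψ).toLinearMap) hd).mp hΦψ
  let σ := AlgEquiv.ofBijective (Φ.comp ψ) hbij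
  have hσ : ∀ z, Φ (ψ (σ.symm z)) = z := σ.apply_symm_apply
  let π : A →ₐ[k] A := ψ.comp (σ.symm.toAlgHom.comp Φ)
  have hπ : ∀ x, π x = ψ (σ.symm (Φ x)) := fun _ => rfl
  refine ⟨π, inferInstance, fun χ => ψ (σ.symm (Pi.single χ 1)), fun x => ?_, fun x => ?_,
    fun g hg => ?_, fun χ x => congrFun (hσ (Φ x)) χ⟩
  · rw [hπ]
    conv_lhs => rw [pi_eq_sum_univ' (Φ x)]
    simp only [map_sum, map_smul]
    rfl
  · rw [setOf_isGrouplike, hπ, hψc, ← Finsupp.range_linearCombination]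
    exact ⟨_, rfl⟩
  · have : g = ψ (MonoidAlgebra.of k G ⟨g, isGrouplike_iff.mp hg⟩) :=
      (hψ ⟨g, isGrouplike_iff.mp hg⟩).symm
    rw [hπ, this]
    exact congrArg ψ (σ.symm_apply_apply _)

end Projection

section Biproduct

variable {k} {A : Type*} [Ring A] [HopfAlgebra k A] {π : A →ₐ[k] A}

lemma comul_algHom_of_eq_sum_characters [Fintype (A →ₐ[k] k)] {e : (A →ₐ[k] k) → A}
    (he : ∀ x, π x = ∑ χ : A →ₐ[k] k, χ x • e χ)
    (hmem : ∀ x, π x ∈ Submodule.span k {g : A | IsGrouplike k A g})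
    (hfix : ∀ g, IsGrouplike k A g → π g = g) (hχ : ∀ (χ : A →ₐ[k] k) x, χ (π x) = χ x) (x : A) :
    Coalgebra.comul (R := k) (π x) =
      TensorProduct.map π.toLinearMap π.toLinearMap (Coalgebra.comul (R := k) x) := by
  let μ : (A →ₐ[k] k) → (A →ₐ[k] k) → A →ₐ[k] k := fun χ χ' =>
    (Algebra.TensorProduct.lmul' k).comp
      ((Algebra.TensorProduct.map χ χ').comp (Bialgebra.comulAlgHom k A))
  have hmap : ∀ t : A ⊗[k] A, TensorProduct.map π.toLinearMap π.toLinearMap t =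
      ∑ χ, ∑ χ', Algebra.TensorProduct.lmul' k (Algebra.TensorProduct.map χ χ' t) •
        (e χ ⊗ₜ[k] e χ') := by
    intro t
    induction t with
    | zero => simp
    | add s t hs ht => simp only [map_add, hs, ht, add_smul, Finset.sum_add_distrib]
    | tmul a b =>
      rw [TensorProduct.map_tmul, AlgHom.toLinearMap_apply, AlgHom.toLinearMap_apply, he a, he b,
        TensorProduct.sum_tmul]
      refine Finset.sum_congr rfl fun χ _ => ?_
      rw [TensorProduct.tmul_sum]
      refine Finset.sum_congr rfl fun χ' _ => ?_
      rw [TensorProduct.smul_tmul_smul, Algebra.TensorProduct.map_tmul,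
        Algebra.TensorProduct.lmul'_apply_tmul]
  have hdom : ∀ y, TensorProduct.map π.toLinearMap π.toLinearMap (Coalgebra.comul (R := k) y) =
      ∑ χ, ∑ χ', μ χ χ' y • (e χ ⊗ₜ[k] e χ') := fun y => hmap _
  have hspan : Set.EqOn (TensorProduct.map π.toLinearMap π.toLinearMap ∘ₗ
      Coalgebra.comul (R := k)) (Coalgebra.comul (R := k))
      (Submodule.span k {g : A | IsGrouplike k A g} : Set A) :=
    LinearMap.eqOn_span fun g hg => by simp [hg.2, hfix g hg]
  rw [← hspan (hmem x), LinearMap.comp_apply, hdom, hdom]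
  simp only [hχ]

lemma coinvariants_iff {x : A} : x ∈ coinvariants k π.toLinearMap ↔
    (Algebra.TensorProduct.map (AlgHom.id k A) π) (Bialgebra.comulAlgHom k A x) = x ⊗ₜ 1 := by
  rw [coinvariants, LinearMap.mem_ker, LinearMap.sub_apply, sub_eq_zero]
  rfl

lemma map_comul_sliceRight (c : Module.Dual k A) (f : A →ₗ[k] A) (x : A) :
    TensorProduct.map LinearMap.id f
        (Coalgebra.comul (R := k) (sliceRight (Coalgebra.comul (R := k) x) c)) =
      LinearMap.lTensor A ((TensorProduct.rid k A).toLinearMap ∘ₗ TensorProduct.map f c ∘ₗ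
        Coalgebra.comul (R := k)) (Coalgebra.comul (R := k) x) := by
  have h : ∀ t : A ⊗[k] A,
      TensorProduct.map LinearMap.id f (Coalgebra.comul (R := k) (sliceRight t c)) =
      LinearMap.lTensor A ((TensorProduct.rid k A).toLinearMap ∘ₗ TensorProduct.map f c)
        (TensorProduct.assoc k A A A (LinearMap.rTensor A (Coalgebra.comul (R := k)) t)) := by
    intro t
    induction t with
    | zero => simp [sliceRight]
    | add s t hs ht =>
      have : sliceRight (s + t) c = sliceRight s c + sliceRight t c := by simp [sliceRight]
      simp only [this, map_add, hs, ht]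
    | tmul a b =>
      have : sliceRight (a ⊗ₜ[k] b) c = c b • a := by simp [sliceRight]
      rw [this, LinearMap.rTensor_tmul, map_smul, map_smul]
      generalize Coalgebra.comul (R := k) a = s
      induction s with
      | zero => simp
      | add s t hs ht => simp only [smul_add, TensorProduct.add_tmul, map_add, hs, ht]
      | tmul u v => simp
  rw [h, Coalgebra.coassoc_apply, ← LinearMap.lTensor_comp_apply, LinearMap.comp_assoc]

/-- Radford's biproduct decomposition for a Hopf algebra projection onto the span of the
grouplikes. -/
lemma bijective_mul_coinvariants [Module.Finite k A]
    (hΔ : ∀ x : A, Coalgebra.comul (R := k) (π x) =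
      TensorProduct.map π.toLinearMap π.toLinearMap (Coalgebra.comul (R := k) x))
    (hε : ∀ x : A, Coalgebra.counit (R := k) (π x) = Coalgebra.counit (R := k) x)
    (hmem : ∀ x, π x ∈ Submodule.span k {g : A | IsGrouplike k A g})
    (hfix : ∀ g, IsGrouplike k A g → π g = g) :
    Function.Bijective
      (LinearMap.mul' k A ∘ₗ
        TensorProduct.map (coinvariants k π.toLinearMap).subtype
          (Submodule.span k {g : A | IsGrouplike k A g}).subtype) := by
  classical
  have := finite_groupLike (k := k) (A := A)
  have := Fintype.ofFinite (GroupLike k A)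
  have hfix' : ∀ g : GroupLike k A, π g.val = g.val := fun g => hfix _ (isGrouplike_iff.mpr g.2)
  rw [setOf_isGrouplike] at hmem ⊢
  set K := Submodule.span k (Set.range (GroupLike.val (R := k) (A := A)))
  let κ : Module.Basis (GroupLike k A) k K := Module.Basis.span linearIndep_groupLikeVal
  have hκ : ∀ g, (κ g : A) = g.val := fun g =>
    congrArg Subtype.val (Module.Basis.span_apply linearIndep_groupLikeVal g)
  let p : A →ₗ[k] K := π.toLinearMap.codRestrict K hmem
  have hp : ∀ x, (p x : A) = π x := fun _ => rfl
  let c : GroupLike k A → Module.Dual k A := fun g => κ.coord g ∘ₗ p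
  have hπ : ∀ x, π x = ∑ g, c g x • g.val := fun x => by
    have := congrArg K.subtype (κ.sum_repr (p x))
    simp only [map_sum, map_smul, Submodule.subtype_apply, hκ] at this
    exact this.symm
  have hc : ∀ g h : GroupLike k A, c g h.val = if h = g then 1 else 0 := fun g h => by
    have : p h.val = κ h := Subtype.ext (by rw [hp, hfix', hκ])
    simp [c, this, Finsupp.single_apply]
  have hππ : ∀ x, π (π x) = π x := fun x => by
    rw [hπ x]
    simp [hfix']
  have hcπ : ∀ g, c g ∘ₗ π.toLinearMap = c g := fun g => by
    ext x
    have : p (π x) = p x := Subtype.ext (hππ x)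
    simp [c, this]
  let ρ : A →ₐ[k] A ⊗[k] A :=
    (Algebra.TensorProduct.map (AlgHom.id k A) π).comp (Bialgebra.comulAlgHom k A)
  have hρg : ∀ g : GroupLike k A, ρ g.val = g.val ⊗ₜ g.val := fun g => by
    have : Bialgebra.comulAlgHom k A g.val = g.val ⊗ₜ[k] g.val := g.2.comul_eq_tmul_self
    simp only [ρ, AlgHom.comp_apply, this]
    simp [hfix']
  have hB : ∀ x, x ∈ coinvariants k π.toLinearMap ↔ ρ x = x ⊗ₜ 1 := fun x => coinvariants_iff
  constructor
  · refine (injective_iff_map_eq_zero _).mpr fun t ht => ?_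
    obtain ⟨x, rfl⟩ := TensorProduct.eq_repr_basis_right κ t
    rw [Finsupp.sum_fintype _ _ (by simp)] at ht ⊢
    have h1 : ∑ g, (x g : A) * g.val = 0 := by
      rw [← ht]
      simp [hκ]
    have h2 : ∑ g, ((x g : A) * g.val) ⊗ₜ[k] g.val = 0 := by
      have := congrArg ρ h1
      rw [map_sum, map_zero] at this
      rw [← this]
      refine Finset.sum_congr rfl fun g _ => ?_
      rw [map_mul, hρg, (hB _).mp (x g).2, Algebra.TensorProduct.tmul_mul_tmul, one_mul]
    refine Finset.sum_eq_zero fun g _ => ?_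
    have h3 := congrArg (fun t => sliceRight t (c g)) h2
    simp only [sliceRight_sum, hc, ite_smul, one_smul, zero_smul, Finset.sum_ite_eq',
      Finset.mem_univ, if_true] at h3
    have h4 : x g = 0 :=
      Subtype.ext ((g.2.isUnit.mul_left_eq_zero).mp (by simpa [sliceRight] using h3))
    rw [h4, TensorProduct.zero_tmul]
  · intro a
    have hsum : ∑ g, sliceRight (Coalgebra.comul (R := k) a) (c g) = a := by
      rw [← map_sum]
      have : ∑ g, c g = Coalgebra.counit (R := k) := by
        ext x
        rw [← hε, hπ]
        simp
      rw [this]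
      simp [sliceRight, Coalgebra.lTensor_counit_comul]
    have hslice : ∀ g, ρ (sliceRight (Coalgebra.comul (R := k) a) (c g)) =
        sliceRight (Coalgebra.comul (R := k) a) (c g) ⊗ₜ[k] g.val := by
      intro g
      refine (map_comul_sliceRight (c g) π.toLinearMap a).trans ?_
      have : (TensorProduct.rid k A).toLinearMap ∘ₗ TensorProduct.map π.toLinearMap (c g) ∘ₗ
          Coalgebra.comul (R := k) = (c g).smulRight g.val := by
        ext x
        have hm : TensorProduct.map π.toLinearMap (c g) = TensorProduct.map π.toLinearMap (c g) ∘ₗ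
            TensorProduct.map π.toLinearMap π.toLinearMap := by
          rw [← TensorProduct.map_comp, hcπ]
          congr 1
          ext x
          exact (hππ x).symm
        rw [hm]
        simp only [LinearMap.comp_apply, ← hΔ]
        rw [hπ]
        simp [GroupLike.isGroupLikeElem_val, IsGroupLikeElem.comul_eq_tmul_self, hfix', hc]
      rw [this]
      generalize Coalgebra.comul (R := k) a = s
      induction s with
      | zero => simp [sliceRight]
      | add s t hs ht =>
        have : sliceRight (s + t) (c g) = sliceRight s (c g) + sliceRight t (c g) := by
          simp [sliceRight]
        simp only [this, map_add, hs, ht, TensorProduct.add_tmul]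
      | tmul u v => simp [sliceRight, TensorProduct.smul_tmul]
    have hcoinv : ∀ g, sliceRight (Coalgebra.comul (R := k) a) (c g) * (g⁻¹).val ∈
        coinvariants k π.toLinearMap := by
      intro g
      rw [hB, map_mul, hslice, hρg, Algebra.TensorProduct.tmul_mul_tmul, ← GroupLike.val_mul,
        mul_inv_cancel, GroupLike.val_one]
    refine ⟨∑ g, ⟨_, hcoinv g⟩ ⊗ₜ κ g, ?_⟩
    simp only [map_sum, LinearMap.comp_apply, TensorProduct.map_tmul, Submodule.subtype_apply,
      LinearMap.mul'_apply, hκ, mul_assoc, ← GroupLike.val_mul, inv_mul_cancel, GroupLike.val_one,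
      mul_one]
    exact hsum

end Biproduct


/-- Let `(A,R)` be a minimal triangular pointed Hopf algebra over an
algebraically closed field `k` of characteristic `0`, and set `K := k[G(A)]`, the group
algebra of the group of grouplike elements of `A` (the span of the grouplikes inside `A`).
Then there exists a projection of Hopf algebras `π : A → K` (a surjective Hopf algebra map
restricting to the identity on `K`), and consequently `A = B × K` is a biproduct in the
sense of Radford, where `B = {x ∈ A | (I ⊗ π)Δ(x) = x ⊗ 1}`; i.e. multiplication
induces a linear isomorphism `B ⊗ K ≅ A`. -/
theorem minimal_triangular_pointed_biproduct
    (k : Type u) [Field k] [IsAlgClosed k] [CharZero k]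
    (A : Type v) [Ring A] [HopfAlgebra k A]
    (Q : QuasiTriangular k A) (htri : Q.IsTriangular) (hmin : Q.IsMinimal)
    (hpointed : IsPointed k A) :
    ∃ π : A →ₐ[k] A,
      (∀ x : A, Coalgebra.comul (R := k) (π x) =
          TensorProduct.map π.toLinearMap π.toLinearMap (Coalgebra.comul (R := k) x)) ∧
      (∀ x : A, Coalgebra.counit (R := k) (π x) = Coalgebra.counit (R := k) x) ∧
      LinearMap.range π.toLinearMap = Submodule.span k {g : A | IsGrouplike k A g} ∧
      (∀ x ∈ Submodule.span k {g : A | IsGrouplike k A g}, π x = x) ∧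
      Function.Bijective
        (LinearMap.mul' k A ∘ₗ
          TensorProduct.map (coinvariants k π.toLinearMap).subtype
            (Submodule.span k {g : A | IsGrouplike k A g}).subtype) := by
  obtain ⟨n, a, b, hR, hl, hr, hfin⟩ := hmin.exists_rep htri
  have hu := Q.isUnit
  have hx := Q.hexagon₂
  rw [hR] at hu hx
  have hnil : ∀ x : A, (∀ χ : A →ₐ[k] k, χ x = 0) → IsNilpotent x := fun x h =>
    isNilpotent_of_forall_character
      (fun d _ π hπ => finrank_eq_one_of_surjective hpointed hx hl hr π hπ) h
  obtain ⟨π, _, e, he, hmem, hfix, hχ⟩ :=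
    exists_algHom_projection hnil (nonempty_character_equiv_groupLike hu hx hl hr)
  have hΔ := comul_algHom_of_eq_sum_characters he hmem hfix hχ
  have hε : ∀ x : A, Coalgebra.counit (R := k) (π x) = Coalgebra.counit (R := k) x :=
    hχ (Bialgebra.counitAlgHom k A)
  have hid : ∀ x ∈ Submodule.span k {g : A | IsGrouplike k A g}, π x = x := fun x hx =>
    LinearMap.eqOn_span (f := π.toLinearMap) (g := LinearMap.id) hfix hx
  refine ⟨π, hΔ, hε, le_antisymm ?_ fun x hx => ⟨x, hid x hx⟩, hid,
    bijective_mul_coinvariants hΔ hε hmem hfix⟩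
  rintro _ ⟨x, rfl⟩
  exact hmem x

end Paper
end
end

section
/- Let (A,R) be any triangular pointed Hopf algebra with antipode S over a field k of characteristic 0. Then S⁴ = I, the identity map of A. -/
open TensorProduct

noncomputable section

universe u v w

namespace Paper

variable (k : Type*) [Field k]

section Antipode

open Coalgebra HopfAlgebra

variable {k} {A : Type*} [Ring A] [HopfAlgebra k A]

/-- Coassociativity, read through a linear map out of the triple tensor product. -/
lemma map_sum_coassoc {M : Type*} [AddCommGroup M] [Module k M] (F : A ⊗[k] (A ⊗[k] A) →ₗ[k] M)
    (c : A) :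
    F (TensorProduct.assoc k A A A (comul.rTensor A (comul (R := k) c))) =
      F (comul.lTensor A (comul (R := k) c)) := by
  rw [Coalgebra.coassoc_apply]

lemma sum_antipode_tmul_one_mul_comul (y : A) {ι : Type*} (r : Coalgebra.Repr k y ι) :
    ∑ i ∈ r.index, (antipode k (r.left i) ⊗ₜ[k] (1 : A)) * comul (R := k) (r.right i) =
      1 ⊗ₜ[k] y := by
  let F : A ⊗[k] (A ⊗[k] A) →ₗ[k] A ⊗[k] A :=
    TensorProduct.map (LinearMap.mul' k A ∘ₗ (antipode k).rTensor A) LinearMap.id ∘ₗ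
      (TensorProduct.assoc k A A A).symm.toLinearMap
  have hF (x : A) (t : A ⊗[k] A) : F (x ⊗ₜ t) = (antipode k x ⊗ₜ[k] (1 : A)) * t := by
    induction t with
    | zero => simp
    | add s t hs ht => rw [TensorProduct.tmul_add, map_add, hs, ht, mul_add]
    | tmul a b => simp [F]
  have h := map_sum_coassoc F y
  nth_rw 2 [← r.eq] at h
  simp only [map_sum, LinearMap.lTensor_tmul, hF] at h
  rw [← h]
  have h2 : F ∘ₗ (TensorProduct.assoc k A A A).toLinearMap ∘ₗ comul.rTensor A =
      TensorProduct.map (Algebra.linearMap k A ∘ₗ counit) LinearMap.id := by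
    rw [← mul_antipode_rTensor_comul]
    ext a b
    simp [F, LinearMap.rTensor]
  have h3 := congr($h2 (comul (R := k) y))
  simp only [LinearMap.comp_apply, LinearEquiv.coe_coe] at h3
  rw [h3, ← LinearMap.comp_id (LinearMap.id (R := k) (M := A)), TensorProduct.map_comp,
    LinearMap.comp_apply]
  have h4 := Coalgebra.rTensor_counit_comul (R := k) y
  rw [LinearMap.rTensor] at h4
  rw [h4]
  simp

open WithConv in
/-- The antipode is an anti-coalgebra map. -/
lemma comul_antipode (c : A) :
    comul (R := k) (antipode k c) =
      TensorProduct.map (antipode k) (antipode k)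
        (TensorProduct.comm k A A (comul (R := k) c)) := by
  let G : A →ₗ[k] A ⊗[k] A := TensorProduct.map (antipode k) (antipode k) ∘ₗ
    (TensorProduct.comm k A A).toLinearMap ∘ₗ comul
  suffices hG : toConv G * toConv (comul (R := k) (A := A)) = 1 by
    have := left_inv_eq_right_inv hG (LinearMap.comul_right_inv (R := k) (C := A))
    exact (congr($(congrArg WithConv.ofConv this) c)).symm
  ext c
  rw [(Coalgebra.Repr.arbitrary k c).convMul_apply]
  simp only [LinearMap.convOne_apply]
  let F₀ (d : A) : A ⊗[k] A →ₗ[k] A ⊗[k] A := (LinearMap.mulRight k (comul (R := k) d)) ∘ₗ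
    TensorProduct.map (antipode k) (antipode k) ∘ₗ (TensorProduct.comm k A A).toLinearMap
  let F' : (A ⊗[k] A) ⊗[k] A →ₗ[k] A ⊗[k] A := LinearMap.mul' k (A ⊗[k] A) ∘ₗ
    TensorProduct.map (TensorProduct.map (antipode k) (antipode k) ∘ₗ
      (TensorProduct.comm k A A).toLinearMap) comul
  let F : A ⊗[k] (A ⊗[k] A) →ₗ[k] A ⊗[k] A :=
    F' ∘ₗ (TensorProduct.assoc k A A A).symm.toLinearMap
  have h := map_sum_coassoc F c
  set r := Coalgebra.Repr.arbitrary k c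
  have hl : F (TensorProduct.assoc k A A A (comul.rTensor A (comul (R := k) c))) =
      ∑ i ∈ r.index, G (r.left i) * comul (R := k) (r.right i) := by
    simp only [F, LinearMap.comp_apply, LinearEquiv.coe_coe, LinearEquiv.symm_apply_apply]
    nth_rw 1 [← r.eq]
    simp [F', G]
  have hr (x y : A) : F (x ⊗ₜ comul (R := k) y) = 1 ⊗ₜ (antipode k x * y) := by
    rw [show (1 : A) ⊗ₜ[k] (antipode k x * y) = (1 ⊗ₜ antipode k x) * (1 ⊗ₜ y) by simp,
      ← sum_antipode_tmul_one_mul_comul y (Coalgebra.Repr.arbitrary k y), Finset.mul_sum]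
    conv_lhs => rw [← (Coalgebra.Repr.arbitrary k y).eq]
    simp [TensorProduct.tmul_sum, F, F', ← mul_assoc]
  change ∑ i ∈ r.index, G (r.left i) * comul (R := k) (r.right i) = _
  rw [← hl, h]
  conv_lhs => rw [← r.eq]
  simp only [map_sum, LinearMap.lTensor_tmul, hr]
  rw [← TensorProduct.tmul_sum, sum_antipode_mul_eq_algebraMap_counit]
  rw [Algebra.TensorProduct.algebraMap_apply, Algebra.algebraMap_eq_smul_one,
    TensorProduct.tmul_smul, TensorProduct.smul_tmul']

end Antipode

section Triangular

open Coalgebra HopfAlgebra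

variable {k} {A : Type*} [Ring A] [HopfAlgebra k A] {ι : Type*}

namespace QuasiTriangular

variable (Q : QuasiTriangular k A) {s : Finset ι} {a b : ι → A}

lemma sum_map_comul_tmul (hR : Q.R = ∑ i ∈ s, a i ⊗ₜ[k] b i) {M : Type*} [AddCommGroup M]
    [Module k M] (F : (A ⊗[k] A) ⊗[k] A →ₗ[k] M) :
    ∑ i ∈ s, F (comul (R := k) (a i) ⊗ₜ b i) =
      ∑ i ∈ s, ∑ j ∈ s, F ((a i ⊗ₜ a j) ⊗ₜ (b i * b j)) := by
  have h := congrArg F Q.hexagon₁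
  rw [hR] at h
  simpa [Finset.sum_mul_sum] using h

lemma sum_map_tmul_comul (hR : Q.R = ∑ i ∈ s, a i ⊗ₜ[k] b i) {M : Type*} [AddCommGroup M]
    [Module k M] (F : A ⊗[k] (A ⊗[k] A) →ₗ[k] M) :
    ∑ i ∈ s, F (a i ⊗ₜ comul (R := k) (b i)) =
      ∑ i ∈ s, ∑ j ∈ s, F ((a i * a j) ⊗ₜ (b j ⊗ₜ b i)) := by
  have h := congrArg F Q.hexagon₂
  rw [hR] at h
  simpa [Finset.sum_mul_sum] using h

lemma exists_sum : ∃ s : Finset (A × A), Q.R = ∑ p ∈ s, p.1 ⊗ₜ[k] p.2 :=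
  TensorProduct.exists_finset Q.R

lemma sum_counit_smul_eq_one (hR : Q.R = ∑ i ∈ s, a i ⊗ₜ[k] b i) :
    ∑ i ∈ s, counit (R := k) (a i) • b i = 1 := by
  let e := ∑ i ∈ s, counit (R := k) (a i) • b i
  let F : (A ⊗[k] A) ⊗[k] A →ₗ[k] A ⊗[k] A :=
    TensorProduct.map (TensorProduct.lid k A ∘ₗ counit.rTensor A) LinearMap.id
  have h := Q.sum_map_comul_tmul hR F
  have h1 : (1 ⊗ₜ[k] e) * Q.R = Q.R := by
    conv_rhs => rw [hR]
    refine Eq.trans ?_ (h.symm.trans ?_)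
    · rw [hR]
      simp [F, e, TensorProduct.tmul_sum, Finset.sum_mul_sum, TensorProduct.smul_tmul']
    · simp [F]
  have h2 : (1 : A) ⊗ₜ[k] e = 1 := by
    obtain ⟨v, hv⟩ := Q.isUnit
    rw [← hv] at h1
    exact (Units.mul_left_inj v).1 (by rw [h1, one_mul])
  have h3 := congrArg ((TensorProduct.lid k A).toLinearMap ∘ₗ counit.rTensor A) h2
  simpa [Algebra.TensorProduct.one_def] using h3

lemma rTensor_antipode_mul : (antipode k).rTensor A Q.R * Q.R = 1 := by
  obtain ⟨s, hR⟩ := Q.exists_sum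
  let F : (A ⊗[k] A) ⊗[k] A →ₗ[k] A ⊗[k] A :=
    TensorProduct.map (LinearMap.mul' k A ∘ₗ (antipode k).rTensor A) LinearMap.id
  have h := Q.sum_map_comul_tmul hR F
  have h1 : (antipode k).rTensor A Q.R * Q.R =
      ∑ i ∈ s, ∑ j ∈ s, F ((i.1 ⊗ₜ j.1) ⊗ₜ (i.2 * j.2)) := by
    rw [hR]
    simp [F, Finset.sum_mul_sum]
  rw [h1, ← h]
  simp only [F, TensorProduct.map_tmul, LinearMap.comp_apply, mul_antipode_rTensor_comul_apply,
    LinearMap.id_apply, Algebra.algebraMap_eq_smul_one, TensorProduct.smul_tmul]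
  rw [← TensorProduct.tmul_sum, Q.sum_counit_smul_eq_one hR, Algebra.TensorProduct.one_def]

/-- Conjugation by the Drinfeld element is the square of the antipode. -/
lemma drinfeld_mul (x : A) : Q.drinfeld * x = antipode k (antipode k x) * Q.drinfeld := by
  obtain ⟨s, hR⟩ := Q.exists_sum
  have hu : Q.drinfeld = ∑ i ∈ s, antipode k i.2 * i.1 := by
    rw [drinfeld, drinfeldOf, hR]
    simp
  let L : A ⊗[k] A →ₗ[k] A :=
    LinearMap.mul' k A ∘ₗ TensorProduct.comm k A A ∘ₗ (antipode k).lTensor A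
  let F (t : A ⊗[k] A →ₗ[k] A ⊗[k] A) : (A ⊗[k] A) ⊗[k] A →ₗ[k] A :=
    LinearMap.mul' k A ∘ₗ TensorProduct.comm k A A ∘ₗ
      TensorProduct.map (L ∘ₗ t) (antipode k ∘ₗ antipode k)
  have hF (t : A ⊗[k] A →ₗ[k] A ⊗[k] A) (y : A ⊗[k] A) (z : A) :
      F t (y ⊗ₜ z) = antipode k (antipode k z) * L (t y) := by simp [F]
  have hL1 (y z : A) : L (Q.R * y ⊗ₜ z) = antipode k z * Q.drinfeld * y := by
    rw [hu, hR]
    simp [L, Finset.sum_mul, Finset.mul_sum, antipode_mul_antidistrib, mul_assoc]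
  let r := Coalgebra.Repr.arbitrary k x
  have key : F (LinearMap.mulLeft k Q.R) (comul.rTensor A (comul (R := k) x)) =
      F (LinearMap.mulRight k Q.R ∘ₗ TensorProduct.comm k A A)
        (comul.rTensor A (comul (R := k) x)) := by
    rw [← r.eq]
    simp only [map_sum, LinearMap.rTensor_tmul, hF]
    refine Finset.sum_congr rfl fun i _ ↦ ?_
    simp only [LinearMap.mulLeft_apply, LinearMap.comp_apply, LinearMap.mulRight_apply,
      LinearEquiv.coe_coe, Q.intertwine]
  have left : F (LinearMap.mulLeft k Q.R) (comul.rTensor A (comul (R := k) x)) =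
      Q.drinfeld * x := by
    have h := map_sum_coassoc
      (F (LinearMap.mulLeft k Q.R) ∘ₗ (TensorProduct.assoc k A A A).symm.toLinearMap) x
    simp only [LinearMap.comp_apply, LinearEquiv.coe_coe, LinearEquiv.symm_apply_apply] at h
    have hr (y z : A) : F (LinearMap.mulLeft k Q.R) ((TensorProduct.assoc k A A A).symm
        (y ⊗ₜ comul (R := k) z)) = counit (R := k) z • (Q.drinfeld * y) := by
      have hs := congrArg (antipode k)
        (sum_mul_antipode_eq_smul (Coalgebra.Repr.arbitrary k z))
      rw [← (Coalgebra.Repr.arbitrary k z).eq]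
      simp only [TensorProduct.tmul_sum, map_sum, TensorProduct.assoc_symm_tmul, hF,
        LinearMap.mulLeft_apply, hL1]
      simp only [map_sum, antipode_mul_antidistrib, map_smul, antipode_one] at hs
      simp only [← mul_assoc, ← Finset.sum_mul, hs]
      simp
    rw [h]
    nth_rw 1 [← r.eq]
    simp only [map_sum, LinearMap.lTensor_tmul, hr, ← mul_smul_comm]
    rw [← Finset.mul_sum]
    congr 1
    have h3 := congrArg (TensorProduct.rid k A) (Coalgebra.sum_tmul_counit_eq r)
    simpa only [map_sum, TensorProduct.rid_tmul, one_smul] using h3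
  have right : F (LinearMap.mulRight k Q.R ∘ₗ TensorProduct.comm k A A)
      (comul.rTensor A (comul (R := k) x)) = antipode k (antipode k x) * Q.drinfeld := by
    have hr (y : A) : L (TensorProduct.comm k A A (comul (R := k) y) * Q.R) =
        counit (R := k) y • Q.drinfeld := by
      have hs := sum_antipode_mul_eq_smul (Coalgebra.Repr.arbitrary k y)
      rw [← (Coalgebra.Repr.arbitrary k y).eq, hu, hR]
      simp only [map_sum, TensorProduct.comm_tmul, Finset.sum_mul_sum,
        Algebra.TensorProduct.tmul_mul_tmul, L, LinearMap.comp_apply, LinearMap.lTensor_tmul,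
        LinearEquiv.coe_coe, LinearMap.mul'_apply, antipode_mul_antidistrib]
      rw [Finset.sum_comm, Finset.smul_sum]
      refine Finset.sum_congr rfl fun i _ ↦ ?_
      simp only [← mul_assoc]
      simp only [mul_assoc (antipode k i.2)]
      rw [← Finset.mul_sum, ← Finset.sum_mul, hs]
      simp
    rw [← r.eq]
    simp only [map_sum, LinearMap.rTensor_tmul, hF, LinearMap.comp_apply,
      LinearMap.mulRight_apply, LinearEquiv.coe_coe, hr, mul_smul_comm, ← smul_mul_assoc]
    rw [← Finset.sum_mul]
    simp only [← map_smul, ← map_sum]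
    rw [Coalgebra.sum_counit_smul]
  rw [← left, key, right]

lemma counit_drinfeld : counit (R := k) Q.drinfeld = 1 := by
  obtain ⟨s, hR⟩ := Q.exists_sum
  have h := congrArg (counit (R := k)) (Q.sum_counit_smul_eq_one hR)
  rw [drinfeld, drinfeldOf, hR]
  simpa [mul_comm] using h

variable {Q}

lemma IsTriangular.rTensor_antipode (htri : Q.IsTriangular) :
    (antipode k).rTensor A Q.R = TensorProduct.comm k A A Q.R :=
  left_inv_eq_right_inv Q.rTensor_antipode_mul htri

lemma IsTriangular.comm_mul (htri : Q.IsTriangular) : TensorProduct.comm k A A Q.R * Q.R = 1 := by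
  rw [← htri.rTensor_antipode, Q.rTensor_antipode_mul]

lemma IsTriangular.lTensor_antipode_comm (htri : Q.IsTriangular) :
    (antipode k).lTensor A (TensorProduct.comm k A A Q.R) = Q.R := by
  have h := congrArg (TensorProduct.comm k A A) htri.rTensor_antipode
  rw [LinearMap.rTensor, ← TensorProduct.map_comm, TensorProduct.comm_comm] at h
  exact h

lemma IsTriangular.map_antipode (htri : Q.IsTriangular) :
    TensorProduct.map (antipode k) (antipode k) Q.R = Q.R := by
  conv_rhs => rw [← htri.lTensor_antipode_comm, ← htri.rTensor_antipode]
  rw [← LinearMap.comp_apply, LinearMap.lTensor_comp_rTensor]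

lemma IsTriangular.comul_drinfeld (htri : Q.IsTriangular) :
    comul (R := k) Q.drinfeld = Q.drinfeld ⊗ₜ[k] Q.drinfeld := by
  obtain ⟨s, hR⟩ := Q.exists_sum
  have hu : Q.drinfeld = ∑ i ∈ s, antipode k i.2 * i.1 := by
    rw [drinfeld, drinfeldOf, hR]
    simp
  let σ : A ⊗[k] A →ₗ[k] A ⊗[k] A :=
    TensorProduct.map (antipode k) (antipode k) ∘ₗ (TensorProduct.comm k A A).toLinearMap
  have hσ (x y : A ⊗[k] A) : σ (x * y) = σ y * σ x := by
    induction x with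
    | zero => simp
    | add x₁ x₂ h₁ h₂ => simp only [add_mul, map_add, mul_add, h₁, h₂]
    | tmul c d =>
      induction y with
      | zero => simp
      | add y₁ y₂ h₁ h₂ => simp only [add_mul, map_add, mul_add, h₁, h₂]
      | tmul e f => simp [σ, antipode_mul_antidistrib]
  have hσt (x y : A) : σ (x ⊗ₜ y) = antipode k y ⊗ₜ antipode k x := by simp [σ]
  let F₁ : (A ⊗[k] A) ⊗[k] A →ₗ[k] A ⊗[k] A :=
    LinearMap.mul' k (A ⊗[k] A) ∘ₗ (TensorProduct.comm k (A ⊗[k] A) (A ⊗[k] A)).toLinearMap ∘ₗ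
      (σ ∘ₗ comul).lTensor (A ⊗[k] A)
  have hF₁ (t : A ⊗[k] A) (y : A) : F₁ (t ⊗ₜ y) = σ (comul (R := k) y) * t := by simp [F₁]
  let F₂ (z : A ⊗[k] A) (f : A →ₗ[k] A ⊗[k] A) : A ⊗[k] (A ⊗[k] A) →ₗ[k] A ⊗[k] A :=
    LinearMap.mulLeft k z ∘ₗ LinearMap.mul' k (A ⊗[k] A) ∘ₗ
      (TensorProduct.comm k (A ⊗[k] A) (A ⊗[k] A)).toLinearMap ∘ₗ TensorProduct.map f σ
  have hF₂ (z : A ⊗[k] A) (f : A →ₗ[k] A ⊗[k] A) (x : A) (t : A ⊗[k] A) :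
      F₂ z f (x ⊗ₜ t) = z * (σ t * f x) := by simp [F₂]
  let F₄ (z c d e : A) : A ⊗[k] A →ₗ[k] A ⊗[k] A :=
    TensorProduct.map (LinearMap.mulRight k z ∘ₗ antipode k)
      (LinearMap.mulLeft k c ∘ₗ LinearMap.mulLeft k d ∘ₗ LinearMap.mulRight k e) ∘ₗ
        (TensorProduct.comm k A A).toLinearMap
  let F₅ (c e : A) : A ⊗[k] A →ₗ[k] A ⊗[k] A :=
    TensorProduct.map (LinearMap.mulLeft k Q.drinfeld)
      (LinearMap.mulLeft k c ∘ₗ LinearMap.mulRight k e ∘ₗ antipode k)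
  calc comul (R := k) Q.drinfeld
      = ∑ i ∈ s, F₁ (comul (R := k) i.1 ⊗ₜ i.2) := by
        simp only [hu, map_sum, Bialgebra.comul_mul, comul_antipode, hF₁]
        rfl
    _ = ∑ j ∈ s, ∑ i ∈ s, F₂ (σ (comul (R := k) j.2)) ((TensorProduct.mk k A A).flip j.1)
          (i.1 ⊗ₜ comul (R := k) i.2) := by
        rw [Q.sum_map_comul_tmul hR, Finset.sum_comm]
        simp only [hF₁, hF₂, Bialgebra.comul_mul, hσ, mul_assoc]
        rfl
    _ = ∑ l ∈ s, ∑ j ∈ s, F₂ 1 (TensorProduct.mk k A A (Q.drinfeld * l.1) ∘ₗ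
          LinearMap.mulLeft k (antipode k l.2)) (j.1 ⊗ₜ comul (R := k) j.2) := by
        rw [Finset.sum_comm]
        conv_rhs => rw [Finset.sum_comm]
        rw [Finset.sum_comm]
        refine Finset.sum_congr rfl fun j _ ↦ ?_
        rw [Q.sum_map_tmul_comul hR, Finset.sum_comm]
        refine Finset.sum_congr rfl fun l _ ↦ ?_
        simp only [hF₂, hσt, one_mul, ← Finset.mul_sum]
        congr 1
        simp [hu, Finset.sum_mul, mul_assoc]
    _ = ∑ l ∈ s, ∑ m ∈ s, ∑ j ∈ s, F₄ (Q.drinfeld * l.1) (antipode k m.2) (antipode k l.2) m.1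
          (j.1 ⊗ₜ j.2) := by
        refine Finset.sum_congr rfl fun l _ ↦ ?_
        rw [Q.sum_map_tmul_comul hR, Finset.sum_comm]
        simp [hF₂, hσt, F₄, mul_assoc]
    _ = ∑ l ∈ s, ∑ m ∈ s, ∑ j ∈ s, F₄ (Q.drinfeld * l.1) (antipode k m.2) (antipode k l.2) m.1
          (antipode k j.1 ⊗ₜ antipode k j.2) := by
        refine Finset.sum_congr rfl fun l _ ↦ Finset.sum_congr rfl fun m _ ↦ ?_
        have h := htri.map_antipode
        rw [hR] at h
        simp only [← map_sum]
        rw [← h]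
        simp
    _ = ∑ m ∈ s, F₅ (antipode k m.2) m.1 (TensorProduct.comm k A A Q.R * Q.R) := by
        rw [Finset.sum_comm]
        refine Finset.sum_congr rfl fun m _ ↦ ?_
        rw [hR, Finset.sum_comm]
        simp [F₄, F₅, Finset.sum_mul_sum, ← mul_assoc, Q.drinfeld_mul, antipode_mul_antidistrib]
    _ = Q.drinfeld ⊗ₜ[k] Q.drinfeld := by
        rw [htri.comm_mul]
        rw [show Q.drinfeld ⊗ₜ[k] Q.drinfeld =
          ∑ m ∈ s, Q.drinfeld ⊗ₜ[k] (antipode k m.2 * m.1) by rw [← TensorProduct.tmul_sum, ← hu]]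
        simp [F₅, Algebra.TensorProduct.one_def]

end QuasiTriangular

end Triangular

section Contraction

open Coalgebra

variable {k} {A : Type*} [Ring A] [HopfAlgebra k A]

/-- The linear map `p ↦ (p ⊗ id)(t)`. -/
def contract (t : A ⊗[k] A) : Module.Dual k A →ₗ[k] A :=
  (TensorProduct.lid k A).toLinearMap ∘ₗ (LinearMap.rTensorHom A).flip t

lemma contract_tmul (x y : A) (p : Module.Dual k A) :
    contract (x ⊗ₜ[k] y) p = p x • y := by
  simp [contract]

lemma contract_add (t t' : A ⊗[k] A) : contract (t + t') = contract t + contract t' := by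
  simp [contract, LinearMap.comp_add]

lemma contract_zero : contract (0 : A ⊗[k] A) = 0 := by
  simp [contract]

lemma contract_sum {ι : Type*} (s : Finset ι) (a b : ι → A) (p : Module.Dual k A) :
    contract (∑ i ∈ s, a i ⊗ₜ[k] b i) p = ∑ i ∈ s, p (a i) • b i := by
  simp [contract]

lemma contract_injective : Function.Injective (contract (k := k) (A := A)) := by
  classical
  intro t t' h
  let e := Module.Basis.ofVectorSpace k A
  refine (TensorProduct.equivFinsuppOfBasisLeft (N := A) e).injective (Finsupp.ext fun i ↦ ?_)
  rw [TensorProduct.equivFinsuppOfBasisLeft_apply, TensorProduct.equivFinsuppOfBasisLeft_apply]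
  exact congr($h (e.coord i))

lemma contract_lTensor (f : A →ₗ[k] A) (t : A ⊗[k] A) (p : Module.Dual k A) :
    contract (f.lTensor A t) p = f (contract t p) := by
  induction t with
  | zero => simp [contract_zero]
  | add s t hs ht => simp [contract_add, hs, ht]
  | tmul x y => simp [contract_tmul]

lemma contract_rTensor (f : A →ₗ[k] A) (t : A ⊗[k] A) (p : Module.Dual k A) :
    contract (f.rTensor A t) p = contract t (p ∘ₗ f) := by
  induction t with
  | zero => simp [contract_zero]
  | add s t hs ht => simp [contract_add, hs, ht]
  | tmul x y => simp [contract_tmul]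

lemma apply_contract_comm (t : A ⊗[k] A) (p q : Module.Dual k A) :
    p (contract (TensorProduct.comm k A A t) q) = q (contract t p) := by
  induction t with
  | zero => simp [contract_zero]
  | add s t hs ht => simp [contract_add, hs, ht]
  | tmul x y => simp [contract_tmul, mul_comm]

/-- The convolution product of two linear functionals. -/
def convolution (p q : Module.Dual k A) : Module.Dual k A :=
  LinearMap.mul' k k ∘ₗ TensorProduct.map p q ∘ₗ comul

lemma apply_contract_comul (p q : Module.Dual k A) (x : A) :
    q (contract (comul (R := k) x) p) = convolution p q x := by
  simp only [convolution, LinearMap.comp_apply]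
  induction comul (R := k) x with
  | zero => simp [contract_zero]
  | add s t hs ht => simp [contract_add, hs, ht]
  | tmul x y => simp [contract_tmul]

lemma convolution_apply_of_isGroupLikeElem (p q : Module.Dual k A) {g : A}
    (hg : IsGroupLikeElem k g) : convolution p q g = p g * q g := by
  simp [convolution, hg.comul_eq_tmul_self]

lemma exists_projection (V : Submodule k A) :
    ∃ f : A →ₗ[k] A, (∀ x, f x ∈ V) ∧ ∀ x ∈ V, f x = x := by
  obtain ⟨f, hf⟩ := V.subtype.exists_leftInverse_of_injective V.ker_subtype
  exact ⟨V.subtype ∘ₗ f, fun x ↦ (f x).2, fun x hx ↦ congr(V.subtype ($hf ⟨x, hx⟩))⟩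

lemma map_eq_self_of_contract_mem {V : Submodule k A} {f : A →ₗ[k] A} (hf : ∀ x ∈ V, f x = x)
    {t : A ⊗[k] A} (h₁ : ∀ p, contract t p ∈ V)
    (h₂ : ∀ p, contract (TensorProduct.comm k A A t) p ∈ V) : TensorProduct.map f f t = t := by
  have hl : f.lTensor A t = t :=
    contract_injective <| LinearMap.ext fun p ↦ by rw [contract_lTensor, hf _ (h₁ p)]
  have hr : f.rTensor A t = t := by
    apply (TensorProduct.comm k A A).injective
    rw [LinearMap.rTensor, ← TensorProduct.map_comm]
    exact contract_injective <| LinearMap.ext fun p ↦ by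
      rw [← LinearMap.lTensor, contract_lTensor, hf _ (h₂ p)]
  conv_rhs => rw [← hl, ← hr]
  rw [← LinearMap.comp_apply, LinearMap.lTensor_comp_rTensor]

lemma mem_range_map_subtype_of_contract {V : Submodule k A} {t : A ⊗[k] A}
    (h₁ : ∀ p ∈ V.dualAnnihilator, contract t p = 0)
    (h₂ : ∀ p ∈ V.dualAnnihilator, contract (TensorProduct.comm k A A t) p = 0) :
    t ∈ LinearMap.range (TensorProduct.map V.subtype V.subtype) := by
  have mem (x : A) (h : ∀ p ∈ V.dualAnnihilator, p x = 0) : x ∈ V := by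
    rw [← Subspace.dualAnnihilator_dualCoannihilator_eq (W := V)]
    exact (Submodule.mem_dualCoannihilator _).2 h
  obtain ⟨f, hfV, hf⟩ := exists_projection V
  have ht : TensorProduct.map f f t = t := by
    refine map_eq_self_of_contract_mem hf (fun p ↦ mem _ fun q hq ↦ ?_)
      (fun p ↦ mem _ fun q hq ↦ ?_)
    · rw [← apply_contract_comm, h₂ q hq, map_zero]
    · rw [apply_contract_comm, h₁ q hq, map_zero]
  rw [← ht]
  refine ⟨TensorProduct.map (f.codRestrict V hfV) (f.codRestrict V hfV) t, ?_⟩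
  rw [← LinearMap.comp_apply, ← TensorProduct.map_comp]
  rfl

lemma convolution_mem_dualAnnihilator {E : Submodule k A}
    (hE : IsSubcoalgebraOf k (comul (R := k) (A := A)) E) {p : Module.Dual k A}
    (hp : p ∈ E.dualAnnihilator) (q : Module.Dual k A) :
    convolution p q ∈ E.dualAnnihilator ∧ convolution q p ∈ E.dualAnnihilator := by
  rw [Submodule.mem_dualAnnihilator] at hp
  have h (f g : Module.Dual k A)
      (hfg : TensorProduct.map (f ∘ₗ E.subtype) (g ∘ₗ E.subtype) = 0) :
      convolution f g ∈ E.dualAnnihilator := by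
    refine (Submodule.mem_dualAnnihilator _).2 fun x hx ↦ ?_
    obtain ⟨t, ht⟩ := hE x hx
    rw [convolution, LinearMap.comp_apply, LinearMap.comp_apply, ← ht,
      ← LinearMap.comp_apply (TensorProduct.map f g), ← TensorProduct.map_comp, hfg]
    simp
  have hp0 : p ∘ₗ E.subtype = 0 := LinearMap.ext fun x ↦ hp x x.2
  exact ⟨h p q (by simp [hp0]), h q p (by simp [hp0])⟩

lemma exists_isGroupLikeElem_of_finrank_eq_one {V : Submodule k A}
    (hV : IsSubcoalgebraOf k (comul (R := k) (A := A)) V) (h1 : Module.finrank k V = 1) :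
    ∃ g : A, IsGroupLikeElem k g ∧ V = Submodule.span k {g} := by
  obtain ⟨v, hv0, hv⟩ := finrank_eq_one_iff'.1 h1
  obtain ⟨t, ht⟩ := hV v v.2
  obtain ⟨c, hc⟩ : ∃ c : k, comul (R := k) (v : A) = c • ((v : A) ⊗ₜ[k] (v : A)) := by
    rw [← ht]
    clear ht
    induction t with
    | zero => exact ⟨0, by simp⟩
    | add s t hs ht =>
      obtain ⟨c, hc⟩ := hs
      obtain ⟨d, hd⟩ := ht
      exact ⟨c + d, by rw [map_add, hc, hd, add_smul]⟩
    | tmul x y =>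
      obtain ⟨c, rfl⟩ := hv x
      obtain ⟨d, rfl⟩ := hv y
      exact ⟨c * d, by rw [TensorProduct.smul_tmul_smul, map_smul, TensorProduct.map_tmul]; rfl⟩
  have hv0' : (v : A) ≠ 0 := fun h ↦ hv0 (Subtype.ext h)
  have hcv : c * counit (R := k) (v : A) = 1 := by
    have h := Coalgebra.rTensor_counit_comul (R := k) (v : A)
    rw [hc] at h
    have h' := congrArg (TensorProduct.lid k A) h
    simp only [map_smul, LinearMap.rTensor_tmul, TensorProduct.lid_tmul, one_smul,
      smul_smul] at h'
    exact smul_left_injective k hv0' (h'.trans (one_smul _ _).symm)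
  refine ⟨c • (v : A), ⟨by simpa using hcv, ?_⟩, le_antisymm (fun x hx ↦ ?_) ?_⟩
  · rw [map_smul, hc, TensorProduct.smul_tmul_smul, smul_smul]
  · obtain ⟨d, hd⟩ := hv ⟨x, hx⟩
    have hd' : d • (v : A) = x := congrArg Subtype.val hd
    refine Submodule.mem_span_singleton.2 ⟨d * counit (R := k) (v : A), ?_⟩
    rw [smul_smul, mul_assoc, mul_comm (counit (R := k) (v : A)), hcv, mul_one, hd']
  · rw [Submodule.span_singleton_le_iff_mem]
    exact V.smul_mem c v.2

end Contraction

section Artinian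

/-- An element of an Artinian ring that vanishes in every simple quotient is nilpotent. -/
lemma isNilpotent_of_forall_simple {B : Type v} [Ring B] [IsArtinianRing B] (x : B)
    (h : ∀ (T : Type v) [Ring T] [IsSimpleRing T] (φ : B →+* T),
      Function.Surjective φ → φ x = 0) : IsNilpotent x := by
  obtain ⟨n, hn⟩ := IsSemiprimaryRing.isNilpotent (R := B)
  suffices hx : x ∈ Ring.jacobson B by
    exact ⟨n, by simpa [hn] using Ideal.pow_mem_pow hx n⟩
  obtain ⟨m, D, d, _, hd, ⟨e⟩⟩ :=
    IsSemisimpleRing.exists_ringEquiv_pi_matrix_divisionRing (B ⧸ Ring.jacobson B)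
  rw [← Ideal.Quotient.eq_zero_iff_mem, ← e.map_eq_zero_iff]
  funext i
  exact h _ ((Pi.evalRingHom _ i).comp (e.toRingHom.comp (Ideal.Quotient.mk _)))
    ((Function.surjective_eval i).comp (e.surjective.comp Ideal.Quotient.mk_surjective))

/-- In characteristic zero, a unipotent element of finite order is trivial. -/
lemma eq_one_of_pow_eq_one_of_isNilpotent {B : Type*} [Ring B] [Algebra k B] [CharZero k] {x : B}
    {n : ℕ} (hn : n ≠ 0) (hx : x ^ n = 1) (h : IsNilpotent (x - 1)) : x = 1 := by
  have hs (m : ℕ) : ∃ y, Commute y (x - 1) ∧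
      ∑ i ∈ Finset.range m, x ^ i = (m : B) + y * (x - 1) := by
    refine ⟨∑ i ∈ Finset.range m, ∑ j ∈ Finset.range i, x ^ j, ?_, ?_⟩
    · refine Commute.sum_left _ _ _ fun i _ ↦ Commute.sum_left _ _ _ fun j _ ↦ ?_
      exact ((Commute.refl x).pow_left j).sub_right (Commute.one_right _)
    · rw [Finset.sum_mul]
      simp [geom_sum_mul]
  obtain ⟨y, hy, hy'⟩ := hs n
  have hu : IsUnit (∑ i ∈ Finset.range n, x ^ i) := by
    rw [hy', add_comm]
    have hn' : IsUnit (n : B) := by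
      simpa using (IsUnit.mk0 (n : k) (Nat.cast_ne_zero.2 hn)).map (algebraMap k B)
    exact (hy.isNilpotent_mul_left h).isUnit_add_right_of_commute hn' (Nat.cast_commute n _).symm
  have h0 : (∑ i ∈ Finset.range n, x ^ i) * (x - 1) = 0 := by rw [geom_sum_mul, hx, sub_self]
  exact sub_eq_zero.1 (hu.mul_right_eq_zero.1 h0)

end Artinian

section Leg

open Coalgebra HopfAlgebra

variable {k} {A : Type*} [Ring A] [HopfAlgebra k A]

namespace QuasiTriangular

variable (Q : QuasiTriangular k A)

lemma contract_convolution (p q : Module.Dual k A) :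
    contract Q.R (convolution p q) = contract Q.R p * contract Q.R q := by
  obtain ⟨s, hR⟩ := Q.exists_sum
  have h := Q.sum_map_comul_tmul hR ((TensorProduct.lid k A).toLinearMap ∘ₗ
    (LinearMap.mul' k k ∘ₗ TensorProduct.map p q).rTensor A)
  rw [hR]
  simp only [contract_sum, convolution]
  simpa [Finset.sum_mul_sum, smul_smul, mul_comm] using h

lemma contract_counit : contract Q.R (counit (R := k)) = 1 := by
  obtain ⟨s, hR⟩ := Q.exists_sum
  rw [← Q.sum_counit_smul_eq_one hR, hR, contract_sum]

/-- The subalgebra spanned by the right tensor components of the R-matrix. -/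
def leg : Subalgebra k A where
  carrier := Set.range (contract Q.R)
  mul_mem' := by
    rintro _ _ ⟨p, rfl⟩ ⟨q, rfl⟩
    exact ⟨convolution p q, Q.contract_convolution p q⟩
  add_mem' := by
    rintro _ _ ⟨p, rfl⟩ ⟨q, rfl⟩
    exact ⟨p + q, map_add _ p q⟩
  algebraMap_mem' c :=
    ⟨c • counit (R := k), by rw [map_smul, Q.contract_counit, Algebra.algebraMap_eq_smul_one]⟩

/-- The map `p ↦ (p ⊗ id)(R)` onto the subalgebra `Q.leg`. -/
def toLeg : Module.Dual k A →ₗ[k] Q.leg where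
  toFun p := ⟨contract Q.R p, p, rfl⟩
  map_add' p q := Subtype.ext (map_add _ p q)
  map_smul' c p := Subtype.ext (map_smul _ c p)

lemma coe_toLeg (p : Module.Dual k A) : (Q.toLeg p : A) = contract Q.R p := rfl

lemma toLeg_surjective : Function.Surjective Q.toLeg := by
  rintro ⟨_, p, rfl⟩
  exact ⟨p, rfl⟩

lemma toLeg_convolution (p q : Module.Dual k A) :
    Q.toLeg (convolution p q) = Q.toLeg p * Q.toLeg q :=
  Subtype.ext (Q.contract_convolution p q)

lemma toLeg_counit : Q.toLeg (counit (R := k)) = 1 :=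
  Subtype.ext Q.contract_counit

instance finiteDimensional_leg : FiniteDimensional k Q.leg := by
  obtain ⟨s, hR⟩ := Q.exists_sum
  have hle : Subalgebra.toSubmodule Q.leg ≤ Submodule.span k (Prod.snd '' (s : Set (A × A))) := by
    rintro _ ⟨p, rfl⟩
    rw [hR, contract_sum]
    exact Submodule.sum_mem _ fun i hi ↦ Submodule.smul_mem _ _
      (Submodule.subset_span ⟨i, hi, rfl⟩)
  have : FiniteDimensional k (Submodule.span k (Prod.snd '' (s : Set (A × A)))) :=
    FiniteDimensional.span_of_finite k (s.finite_toSet.image _)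
  exact Submodule.finiteDimensional_of_le hle

section SimpleQuotient

variable {T : Type*} [Ring T] (φ : Q.leg →+* T)

/-- The subspace of `A` dual to the quotient `φ` of `Q.leg`. -/
def dualSubspace : Submodule k A :=
  ((((RingHom.ker φ).restrictScalars k).map Q.leg.val.toLinearMap).dualAnnihilator).map
    (contract (TensorProduct.comm k A A Q.R))

lemma mem_dualAnnihilator_dualSubspace (p : Module.Dual k A) :
    p ∈ (Q.dualSubspace φ).dualAnnihilator ↔ φ (Q.toLeg p) = 0 := by
  set I := ((RingHom.ker φ).restrictScalars k).map Q.leg.val.toLinearMap with hI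
  have h1 : p ∈ (Q.dualSubspace φ).dualAnnihilator ↔ contract Q.R p ∈ I := by
    rw [← Subspace.dualAnnihilator_dualCoannihilator_eq (W := I), Submodule.mem_dualCoannihilator,
      Submodule.mem_dualAnnihilator]
    simp only [dualSubspace, ← hI, Submodule.mem_map, forall_exists_index, and_imp,
      forall_apply_eq_imp_iff₂, apply_contract_comm]
  rw [h1, ← coe_toLeg]
  refine ⟨?_, fun h ↦ ⟨Q.toLeg p, h, rfl⟩⟩
  rintro ⟨y, hy, hyp⟩
  rw [← Subtype.ext hyp]
  exact hy

lemma isSubcoalgebraOf_dualSubspace :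
    IsSubcoalgebraOf k (comul (R := k) (A := A)) (Q.dualSubspace φ) := by
  intro x hx
  have key (r : Module.Dual k A) (hr : φ (Q.toLeg r) = 0) : r x = 0 :=
    (Submodule.mem_dualAnnihilator _).1 ((Q.mem_dualAnnihilator_dualSubspace φ r).2 hr) x hx
  refine mem_range_map_subtype_of_contract (fun p hp ↦ ?_) (fun p hp ↦ ?_) <;>
    rw [Q.mem_dualAnnihilator_dualSubspace φ] at hp <;>
    refine (Module.forall_dual_apply_eq_zero_iff k _).1 fun q ↦ ?_
  · rw [apply_contract_comul]
    exact key _ (by rw [Q.toLeg_convolution, map_mul, hp, zero_mul])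
  · rw [apply_contract_comm, apply_contract_comul]
    exact key _ (by rw [Q.toLeg_convolution, map_mul, hp, mul_zero])

lemma isSimpleSubcoalgebraOf_dualSubspace [IsSimpleRing T] (hφ : Function.Surjective φ) :
    IsSimpleSubcoalgebraOf k (comul (R := k) (A := A)) (Q.dualSubspace φ) := by
  refine ⟨fun h ↦ ?_, Q.isSubcoalgebraOf_dualSubspace φ, fun E hE hle ↦ ?_⟩
  · have h1 := (Q.mem_dualAnnihilator_dualSubspace φ (counit (R := k))).1 (by simp [h])
    rw [Q.toLeg_counit, map_one] at h1
    exact one_ne_zero h1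
  have hsurj : Function.Surjective (fun p ↦ φ (Q.toLeg p)) := hφ.comp Q.toLeg_surjective
  by_cases hall : ∀ p ∈ E.dualAnnihilator, φ (Q.toLeg p) = 0
  · right
    refine le_antisymm hle ?_
    rw [← Subspace.dualAnnihilator_dualCoannihilator_eq (W := E),
      ← Subspace.dualAnnihilator_dualCoannihilator_eq (W := Q.dualSubspace φ)]
    exact Submodule.dualCoannihilator_anti fun p hp ↦
      (Q.mem_dualAnnihilator_dualSubspace φ p).2 (hall p hp)
  · left
    push Not at hall
    obtain ⟨p, hp, hp0⟩ := hall
    let J : TwoSidedIdeal T := TwoSidedIdeal.mk' {t | ∃ p ∈ E.dualAnnihilator, φ (Q.toLeg p) = t}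
      ⟨0, zero_mem _, by simp⟩
      (by
        rintro _ _ ⟨p, hp, rfl⟩ ⟨q, hq, rfl⟩
        exact ⟨p + q, add_mem hp hq, by simp⟩)
      (by
        rintro _ ⟨p, hp, rfl⟩
        exact ⟨-p, neg_mem hp, by simp⟩)
      (by
        rintro x _ ⟨p, hp, rfl⟩
        obtain ⟨q, rfl⟩ := hsurj x
        exact ⟨convolution q p, (convolution_mem_dualAnnihilator hE hp q).2,
          by simp [Q.toLeg_convolution]⟩)
      (by
        rintro _ x ⟨p, hp, rfl⟩
        obtain ⟨q, rfl⟩ := hsurj x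
        exact ⟨convolution p q, (convolution_mem_dualAnnihilator hE hp q).1,
          by simp [Q.toLeg_convolution]⟩)
    have hJ (t : T) : t ∈ J ↔ ∃ p ∈ E.dualAnnihilator, φ (Q.toLeg p) = t := by
      simp [J, TwoSidedIdeal.mem_mk']
    have h1 : (1 : T) ∈ J := IsSimpleRing.one_mem_of_ne_zero_mem J hp0 ((hJ _).2 ⟨p, hp, rfl⟩)
    have htop (r : Module.Dual k A) : r ∈ E.dualAnnihilator := by
      obtain ⟨q, hq, hqr⟩ := (hJ (φ (Q.toLeg r))).1 (by simpa using J.mul_mem_left _ _ h1)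
      have h2 : r - q ∈ (Q.dualSubspace φ).dualAnnihilator := by
        rw [Q.mem_dualAnnihilator_dualSubspace, map_sub, map_sub, hqr, sub_self]
      simpa using add_mem (Submodule.dualAnnihilator_anti hle h2) hq
    refine (Submodule.eq_bot_iff _).2 fun x hx ↦ ?_
    exact (Module.forall_dual_apply_eq_zero_iff k x).1 fun r ↦
      (Submodule.mem_dualAnnihilator _).1 (htop r) x hx

/-- In the pointed case, the kernel of a simple quotient of `Q.leg` is cut out by a functional
which is dual to a grouplike element. -/
lemma exists_isGroupLikeElem_contract (hpointed : IsPointed k A) [IsSimpleRing T]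
    (hφ : Function.Surjective φ) :
    ∃ χ : Module.Dual k A, IsGroupLikeElem k (contract (TensorProduct.comm k A A Q.R) χ) ∧
      ∀ x : Q.leg, φ x = 0 ↔ χ x = 0 := by
  obtain ⟨g, hg, hV⟩ := exists_isGroupLikeElem_of_finrank_eq_one
    (Q.isSubcoalgebraOf_dualSubspace φ) (hpointed _ (Q.isSimpleSubcoalgebraOf_dualSubspace φ hφ))
  obtain ⟨χ, -, rfl⟩ : g ∈ Q.dualSubspace φ := hV ▸ Submodule.mem_span_singleton_self g
  refine ⟨χ, hg, fun x ↦ ?_⟩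
  obtain ⟨p, rfl⟩ := Q.toLeg_surjective x
  rw [← Q.mem_dualAnnihilator_dualSubspace, coe_toLeg, ← apply_contract_comm,
    Submodule.mem_dualAnnihilator, hV]
  refine ⟨fun h ↦ h _ (Submodule.mem_span_singleton_self _), fun h y hy ↦ ?_⟩
  obtain ⟨c, rfl⟩ := Submodule.mem_span_singleton.1 hy
  rw [map_smul, h, smul_zero]

end SimpleQuotient

end QuasiTriangular

end Leg

section Unipotent

open Coalgebra HopfAlgebra

variable {k} {A : Type*} [Ring A] [HopfAlgebra k A]

lemma contract_map_mul_map {f : A →ₗ[k] A} {ψ : Module.Dual k A}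
    (hψ : ∀ x y, ψ (f x * f y) = ψ (f x) * ψ (f y)) (t t' : A ⊗[k] A) :
    contract (TensorProduct.map f f t * TensorProduct.map f f t') ψ =
      contract (TensorProduct.map f f t) ψ * contract (TensorProduct.map f f t') ψ := by
  induction t with
  | zero => simp [contract_zero]
  | add s t hs ht => simp only [map_add, add_mul, contract_add, LinearMap.add_apply, hs, ht]
  | tmul a b =>
    induction t' with
    | zero => simp [contract_zero]
    | add s t hs ht => simp only [map_add, mul_add, contract_add, LinearMap.add_apply, hs, ht]
    | tmul c d => simp [contract_tmul, hψ, smul_smul, mul_comm]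

namespace QuasiTriangular.IsTriangular

variable {Q : QuasiTriangular k A}

lemma contract_comm (htri : Q.IsTriangular) (p : Module.Dual k A) :
    contract (TensorProduct.comm k A A Q.R) p = contract Q.R (p ∘ₗ antipode k) := by
  rw [← htri.rTensor_antipode, contract_rTensor]

lemma contract_comm_mem_leg (htri : Q.IsTriangular) (p : Module.Dual k A) :
    contract (TensorProduct.comm k A A Q.R) p ∈ Q.leg := by
  rw [htri.contract_comm]
  exact ⟨_, rfl⟩

lemma antipode_mem_leg (htri : Q.IsTriangular) {x : A} (hx : x ∈ Q.leg) :
    antipode k x ∈ Q.leg := by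
  have hle : Subalgebra.toSubmodule Q.leg ≤ (Subalgebra.toSubmodule Q.leg).map (antipode k) := by
    rintro _ ⟨p, rfl⟩
    refine ⟨_, htri.contract_comm_mem_leg p, ?_⟩
    rw [← contract_lTensor, htri.lTensor_antipode_comm]
  have : FiniteDimensional k (Subalgebra.toSubmodule Q.leg) := Q.finiteDimensional_leg
  have heq := Submodule.eq_of_le_of_finrank_le hle (Submodule.finrank_map_le _ _)
  change antipode k x ∈ Subalgebra.toSubmodule Q.leg
  rw [heq]
  exact ⟨x, hx, rfl⟩

lemma exists_projection_leg (htri : Q.IsTriangular) : ∃ f : A →ₗ[k] A, (∀ x, f x ∈ Q.leg) ∧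
    TensorProduct.map f f Q.R = Q.R ∧
    TensorProduct.map f f (TensorProduct.comm k A A Q.R) = TensorProduct.comm k A A Q.R := by
  obtain ⟨f, hfV, hf⟩ := exists_projection (Subalgebra.toSubmodule Q.leg)
  have h : TensorProduct.map f f Q.R = Q.R :=
    map_eq_self_of_contract_mem hf (fun p ↦ ⟨p, rfl⟩) htri.contract_comm_mem_leg
  exact ⟨f, hfV, h, by rw [TensorProduct.map_comm, h]⟩

lemma drinfeld_mem_leg (htri : Q.IsTriangular) : Q.drinfeld ∈ Q.leg := by
  obtain ⟨f, hfV, -, hf⟩ := htri.exists_projection_leg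
  rw [drinfeld, drinfeldOf, ← hf]
  induction TensorProduct.comm k A A Q.R with
  | zero => simp
  | add s t hs ht => simpa using add_mem hs ht
  | tmul x y => simpa using mul_mem (htri.antipode_mem_leg (hfV x)) (hfV y)

lemma contract_mul_contract_comm (htri : Q.IsTriangular) {ψ : Module.Dual k A} (h1 : ψ 1 = 1)
    (hψ : ∀ x ∈ Q.leg, ∀ y ∈ Q.leg, ψ (x * y) = ψ x * ψ y) :
    contract Q.R ψ * contract (TensorProduct.comm k A A Q.R) ψ = 1 := by
  obtain ⟨f, hfV, hf, hf'⟩ := htri.exists_projection_leg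
  rw [← hf', ← hf, hf, ← hf, ← contract_map_mul_map (fun x y ↦ hψ _ (hfV x) _ (hfV y)), hf, hf',
    htri, Algebra.TensorProduct.one_def, contract_tmul, h1, one_smul]

lemma apply_drinfeld (htri : Q.IsTriangular) {ψ : Module.Dual k A}
    (hψ : ∀ x ∈ Q.leg, ∀ y ∈ Q.leg, ψ (x * y) = ψ x * ψ y) :
    ψ Q.drinfeld = ψ (contract (TensorProduct.comm k A A Q.R) (ψ ∘ₗ antipode k)) := by
  obtain ⟨f, hfV, -, hf⟩ := htri.exists_projection_leg
  rw [drinfeld, drinfeldOf, ← hf]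
  induction TensorProduct.comm k A A Q.R with
  | zero => simp [contract_zero]
  | add s t hs ht => simp only [map_add, hs, ht, contract_add, LinearMap.add_apply]
  | tmul x y => simp [contract_tmul, hψ _ (htri.antipode_mem_leg (hfV x)) _ (hfV y)]

/-- A character of `Q.leg` dual to a grouplike element takes the value `1` on the square of the
Drinfeld element. -/
lemma apply_drinfeld_sq (htri : Q.IsTriangular) {χ : Module.Dual k A}
    (hχ : IsGroupLikeElem k (contract (TensorProduct.comm k A A Q.R) χ)) :
    χ 1 = 1 ∧ χ (Q.drinfeld * Q.drinfeld) = 1 := by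
  set g := contract (TensorProduct.comm k A A Q.R) χ with hg
  have hmul : ∀ x ∈ Q.leg, ∀ y ∈ Q.leg, χ (x * y) = χ x * χ y := by
    rintro _ ⟨p, rfl⟩ _ ⟨q, rfl⟩
    rw [← Q.contract_convolution]
    simp only [← apply_contract_comm, ← hg]
    exact convolution_apply_of_isGroupLikeElem p q hχ
  have h1 : χ 1 = 1 := by
    rw [← Q.contract_counit, ← apply_contract_comm, ← hg, hχ.counit_eq_one]
  refine ⟨h1, ?_⟩
  have hgleg : g ∈ Q.leg := htri.contract_comm_mem_leg χ
  have hg2 : χ g * χ g = 1 := by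
    have h := congrArg χ (htri.contract_mul_contract_comm h1 hmul)
    rwa [h1, hmul _ ⟨χ, rfl⟩ _ hgleg, ← apply_contract_comm, ← hg] at h
  have hy : χ g * χ Q.drinfeld = 1 := by
    have h := congrArg χ (htri.contract_mul_contract_comm (ψ := χ ∘ₗ antipode k) (by simp [h1])
      fun x hx y hy ↦ by simp [antipode_mul_antidistrib,
        hmul _ (htri.antipode_mem_leg hy) _ (htri.antipode_mem_leg hx), mul_comm])
    rwa [h1, ← htri.contract_comm χ, ← hg, hmul _ hgleg _ (htri.contract_comm_mem_leg _),
      ← htri.apply_drinfeld hmul] at h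
  rw [hmul _ htri.drinfeld_mem_leg _ htri.drinfeld_mem_leg]
  have : χ Q.drinfeld = χ g := by
    rw [← mul_one (χ Q.drinfeld), ← hg2, ← mul_assoc, mul_comm (χ Q.drinfeld), hy, one_mul]
  rw [this, hg2]

lemma isGroupLikeElem_drinfeld (htri : Q.IsTriangular) : IsGroupLikeElem k Q.drinfeld :=
  ⟨Q.counit_drinfeld, htri.comul_drinfeld⟩

end QuasiTriangular.IsTriangular

lemma exists_pow_eq_one_of_isGroupLikeElem {B : Subalgebra k A} [FiniteDimensional k B] {g : A}
    (hg : IsGroupLikeElem k g) (hgB : g ∈ B) : ∃ n ≠ 0, g ^ n = 1 := by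
  by_contra! h
  have hinj : Function.Injective fun n : ℕ ↦ g ^ n := by
    intro i j hij
    wlog hlt : i < j generalizing i j
    · by_contra hne
      exact hne (this hij.symm (by omega)).symm
    refine absurd ((hg.isUnit.pow i).mul_left_cancel (?_ : g ^ i * g ^ (j - i) = g ^ i * 1))
      (h (j - i) (by omega))
    rw [← pow_add, mul_one, Nat.add_sub_cancel' hlt.le]
    exact hij.symm
  have hli : LinearIndependent k fun n : ℕ ↦ g ^ n :=
    linearIndepOn_isGroupLikeElem.comp (fun n : ℕ ↦ (⟨g ^ n, hg.pow⟩ : {a | IsGroupLikeElem k a}))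
      fun i j hij ↦ hinj congr($hij.1)
  have hli' : LinearIndependent k fun n : ℕ ↦ (⟨g, hgB⟩ : B) ^ n :=
    LinearIndependent.of_comp B.val.toLinearMap (by simpa [Function.comp_def] using hli)
  exact not_finite_iff_infinite.2 inferInstance hli'.finite

lemma QuasiTriangular.IsTriangular.drinfeld_sq_eq_one [CharZero k] {Q : QuasiTriangular k A}
    (htri : Q.IsTriangular) (hpointed : IsPointed k A) : Q.drinfeld * Q.drinfeld = 1 := by
  have hmem : Q.drinfeld * Q.drinfeld ∈ Q.leg :=
    mul_mem htri.drinfeld_mem_leg htri.drinfeld_mem_leg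
  have hw : IsGroupLikeElem k (Q.drinfeld * Q.drinfeld) :=
    htri.isGroupLikeElem_drinfeld.mul htri.isGroupLikeElem_drinfeld
  obtain ⟨n, hn, hpow⟩ := exists_pow_eq_one_of_isGroupLikeElem hw hmem
  have : IsArtinianRing Q.leg := IsArtinianRing.of_finite k Q.leg
  have h : (⟨_, hmem⟩ : Q.leg) = 1 := by
    refine eq_one_of_pow_eq_one_of_isNilpotent k hn (Subtype.ext hpow) ?_
    refine isNilpotent_of_forall_simple _ fun T _ _ φ hφ ↦ ?_
    obtain ⟨χ, hχ, hφχ⟩ := Q.exists_isGroupLikeElem_contract φ hpointed hφ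
    obtain ⟨h1, h2⟩ := htri.apply_drinfeld_sq hχ
    rw [hφχ]
    simp [h1, h2]
  exact congrArg Subtype.val h

end Unipotent

/-- Let `(A,R)` be any triangular pointed Hopf algebra with antipode `S`
over a field `k` of characteristic `0`. Then `S⁴ = I`, the identity map of `A`. -/
theorem antipode_pow_four_eq_id_of_triangular_pointed
    (k : Type u) [Field k] [CharZero k]
    (A : Type v) [Ring A] [HopfAlgebra k A]
    (Q : QuasiTriangular k A) (htri : Q.IsTriangular) (hpointed : IsPointed k A) :
    ∀ x : A,
      HopfAlgebra.antipode (R := k) (HopfAlgebra.antipode (R := k)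
        (HopfAlgebra.antipode (R := k) (HopfAlgebra.antipode (R := k) x))) = x := by
  intro x
  have hu := htri.drinfeld_sq_eq_one hpointed
  rw [← mul_one (HopfAlgebra.antipode k _), ← hu, ← mul_assoc, ← Q.drinfeld_mul, mul_assoc,
    ← Q.drinfeld_mul, ← mul_assoc, hu, one_mul]

end Paper
end
end
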